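/- Under the hypotheses (H0)–(H3) on V with parameters D, C, s, δ_n = n^{−α} (0 < α ≤ 1), and with a a variation sequence of length L and order M > D + s/2 + 1/4, let Z^{(n)} be as before a centered Gaussian vector in ℝ^{n'} (n' = n−L+1) with covariance Σ_n(i,i') = −Σ_j (a^{2*})_j V((i−i'+j)δ_n). Let f : [0,∞) → ℝ be M times continuously differentiable and define Δ_{a,i}(f) = Σ_j a_j f((i+j)δ_n), K^α_{M,n} = sup_{t∈[0,n^{1−α}]} |f^{(M)}(t)|, V^X_{a,n} = Σ_{i=1}^{n'} (Δ_{a,i}(f) + Z^{(n)}_i)², and C^X_{a,n} = V^X_{a,n} / ( n (−1)^D δ_n^{2D+s} R(0,1,2D,|·|^s,a^{2*}) ). If K^α_{M,n} = o( n^{−1/4} δ_n^{D−M+s/2} ) as n → ∞, then (C^X_{a,n} − C) / √(Var(C_{a,n})) converges in distribution to N(0,1), where C_{a,n} and Var(C_{a,n}) are computed from the centered vector Z^{(n)} alone. -/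

import Mathlib

open Filter MeasureTheory ProbabilityTheory Matrix

/-- Convolution of finitely supported sequences: `(a*a')_m = Σ_{k-l=m} a_k a'_l`. -/
noncomputable def seqConv (a a' : ℤ → ℝ) (m : ℤ) : ℝ := ∑ᶠ k : ℤ, a k * a' (k - m)

/-- `R(i,δ,q,f,c) = −Σ_j c_j j^q ∫_0^1 ((1−η)^{q−1}/(q−1)!) f((i+jη)δ) dη` for `q ≥ 1`,
and `R(i,δ,0,f,c) = −Σ_j c_j f((i+j)δ)`. -/
noncomputable def Rq (i : ℤ) (δ : ℝ) (q : ℕ) (f : ℝ → ℝ) (c : ℤ → ℝ) : ℝ :=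
  if q = 0 then -∑ᶠ j : ℤ, c j * f ((i + j) * δ)
  else -∑ᶠ j : ℤ, c j * (j : ℝ) ^ q *
    ∫ η in (0:ℝ)..1, ((1 - η) ^ (q - 1) / (Nat.factorial (q - 1) : ℝ)) * f ((i + j * η) * δ)

/-- The law of the centered Gaussian vector `Z^{(n)} = A_n G_n` (with `G_n` a vector of
i.i.d. standard normal variables), a measure on `ℝ^{n-L+1}`. -/
noncomputable def gaussVec (L : ℕ)
    (A : (n : ℕ) → Matrix (Fin (n - L + 1)) (Fin (n - L + 1)) ℝ) (n : ℕ) :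
    Measure (Fin (n - L + 1) → ℝ) :=
  Measure.map (A n).mulVec (Measure.pi fun _ => gaussianReal 0 1)

/-- The quadratic variation functional `z ↦ Σ_i z_i²`. -/
noncomputable def quadVar (m : ℕ) (z : Fin m → ℝ) : ℝ := ∑ i, (z i) ^ 2

/-- Expectation of the quadratic `a`-variation of the centered vector. -/
noncomputable def expV (L : ℕ)
    (A : (n : ℕ) → Matrix (Fin (n - L + 1)) (Fin (n - L + 1)) ℝ) (n : ℕ) : ℝ :=
  ∫ z, quadVar (n - L + 1) z ∂(gaussVec L A n)

/-- Variance of the quadratic `a`-variation of the centered vector. -/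
noncomputable def varV (L : ℕ)
    (A : (n : ℕ) → Matrix (Fin (n - L + 1)) (Fin (n - L + 1)) ℝ) (n : ℕ) : ℝ :=
  ∫ z, (quadVar (n - L + 1) z - expV L A n) ^ 2 ∂(gaussVec L A n)

/-- The normalizing denominator `n (−1)^D δ_n^{2D+s} R(0,1,2D,|·|^s,a^{2*})` in the
definition of the estimator `C_{a,n}`. -/
noncomputable def denom (a : ℤ → ℝ) (D : ℕ) (s α : ℝ) (n : ℕ) : ℝ :=
  (n : ℝ) * (-1 : ℝ) ^ D * ((n : ℝ) ^ (-α)) ^ (2 * (D : ℝ) + s)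
    * Rq 0 1 (2 * D) (fun x => |x| ^ s) (seqConv a a)

/-- Discrete `a`-difference of the drift: `Δ_{a,i}(f) = Σ_j a_j f((i+j)δ)`. -/
noncomputable def driftDiff (a : ℤ → ℝ) (f : ℝ → ℝ) (δ : ℝ) (i : ℤ) : ℝ :=
  ∑ᶠ j : ℤ, a j * f ((i + j) * δ)

section QuadraticForm

variable {ι : Type*} [Fintype ι] [DecidableEq ι]

/-- Real spectral theorem for `AᵀA`, with the change of basis preserving the standard Gaussian
measure. -/
lemma exists_orthogonal_diagonalization (A : Matrix ι ι ℝ) :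
    ∃ (U : Matrix ι ι ℝ) (lam : ι → ℝ), Uᵀ * U = 1 ∧ U * Uᵀ = 1 ∧
      Aᵀ * A = U * diagonal lam * Uᵀ ∧
      MeasurePreserving (fun x : ι → ℝ => Uᵀ *ᵥ x) (Measure.pi fun _ => gaussianReal 0 1)
        (Measure.pi fun _ => gaussianReal 0 1) := by
  have hH : (Aᵀ * A).IsHermitian := by
    have := isHermitian_conjTranspose_mul_self A
    rwa [conjTranspose_eq_transpose_of_trivial] at this
  set b := hH.eigenvectorBasis with hb
  refine ⟨(hH.eigenvectorUnitary : Matrix ι ι ℝ), hH.eigenvalues, ?_, ?_, ?_, ?_⟩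
  · have := Unitary.coe_star_mul_self hH.eigenvectorUnitary
    rwa [star_eq_conjTranspose, conjTranspose_eq_transpose_of_trivial] at this
  · have := Unitary.coe_mul_star_self hH.eigenvectorUnitary
    rwa [Unitary.coe_star, star_eq_conjTranspose, conjTranspose_eq_transpose_of_trivial] at this
  · have := hH.spectral_theorem
    rw [Unitary.conjStarAlgAut_apply, star_eq_conjTranspose,
      conjTranspose_eq_transpose_of_trivial] at this
    exact this
  · have hT : (fun x : ι → ℝ => (hH.eigenvectorUnitary : Matrix ι ι ℝ)ᵀ *ᵥ x) =
        WithLp.ofLp ∘ (b.repr ∘ WithLp.toLp 2) := by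
      funext x
      ext i
      simp [Matrix.mulVec, dotProduct, OrthonormalBasis.repr_apply_apply, PiLp.inner_apply,
        hb, IsHermitian.eigenvectorUnitary_apply, mul_comm]
    have hm1 : Measurable (WithLp.toLp 2 : (ι → ℝ) → EuclideanSpace ℝ ι) := by fun_prop
    have hm2 : Measurable (WithLp.ofLp : EuclideanSpace ℝ ι → (ι → ℝ)) := by fun_prop
    have hm3 : Measurable (b.repr : EuclideanSpace ℝ ι → EuclideanSpace ℝ ι) := by fun_prop
    refine ⟨by rw [hT]; exact hm2.comp (hm3.comp hm1), ?_⟩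
    rw [hT, ← Measure.map_map hm2 (hm3.comp hm1), ← Measure.map_map hm3 hm1,
      map_pi_eq_stdGaussian, stdGaussian_map, ← map_pi_eq_stdGaussian, Measure.map_map hm2 hm1]
    exact Measure.map_id

omit [DecidableEq ι] in
/-- Row sums bound eigenvalues. -/
lemma abs_eigenvalue_le_of_row_sum_le {S : Matrix ι ι ℝ} {b l : ℝ}
    (hb : ∀ i, ∑ j, |S i j| ≤ b) {w : ι → ℝ} (hw : w ≠ 0) (h : S *ᵥ w = l • w) : |l| ≤ b := by
  obtain ⟨i0, hi0⟩ := Function.ne_iff.1 hw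
  obtain ⟨k, -, hk⟩ := Finset.exists_max_image Finset.univ (fun i => |w i|) ⟨i0, Finset.mem_univ _⟩
  have hkpos : 0 < |w k| := lt_of_lt_of_le (abs_pos.2 hi0) (hk i0 (Finset.mem_univ _))
  refine le_of_mul_le_mul_right ?_ hkpos
  have h1 : l * w k = ∑ j, S k j * w j := by
    have := congrFun h k
    simp only [mulVec, dotProduct, Pi.smul_apply, smul_eq_mul] at this
    exact this.symm
  calc |l| * |w k| = |∑ j, S k j * w j| := by rw [← abs_mul, h1]
    _ ≤ ∑ j, |S k j| * |w k| := by
        refine (Finset.abs_sum_le_sum_abs _ _).trans (Finset.sum_le_sum fun j _ => ?_)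
        rw [abs_mul]
        exact mul_le_mul_of_nonneg_left (hk j (Finset.mem_univ _)) (abs_nonneg _)
    _ = (∑ j, |S k j|) * |w k| := (Finset.sum_mul _ _ _).symm
    _ ≤ b * |w k| := mul_le_mul_of_nonneg_right (hb k) hkpos.le

/-- Diagonal form of the squared norm of a Gaussian vector with covariance `A Aᵀ`. -/
lemma exists_gaussian_quadratic_diag (A : Matrix ι ι ℝ) :
    ∃ (T : (ι → ℝ) → (ι → ℝ)) (lam : ι → ℝ),
      MeasurePreserving T (Measure.pi fun _ => gaussianReal 0 1)
        (Measure.pi fun _ => gaussianReal 0 1) ∧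
      (∀ x, ∑ i, ((A *ᵥ x) i) ^ 2 = ∑ i, lam i * (T x i) ^ 2) ∧
      ∑ i, lam i = (A * Aᵀ).trace ∧
      ∑ i, (lam i) ^ 2 = ∑ i, ∑ j, ((A * Aᵀ) i j) ^ 2 ∧
      ∀ b : ℝ, 0 ≤ b → (∀ i, ∑ j, |(A * Aᵀ) i j| ≤ b) → ∀ i, |lam i| ≤ b := by
  obtain ⟨U, lam, h1, h2, h3, h4⟩ := exists_orthogonal_diagonalization A
  refine ⟨_, lam, h4, fun x => ?_, ?_, ?_, fun b hb0 hb i => ?_⟩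
  · have e1 : ∑ i, ((A *ᵥ x) i) ^ 2 = x ⬝ᵥ (Aᵀ * A) *ᵥ x := by
      rw [← mulVec_mulVec, dotProduct_mulVec, vecMul_transpose]
      simp [dotProduct, pow_two]
    have e2 : x ⬝ᵥ (U * diagonal lam * Uᵀ) *ᵥ x = ∑ i, lam i * ((Uᵀ *ᵥ x) i) ^ 2 := by
      rw [← mulVec_mulVec, ← mulVec_mulVec, dotProduct_mulVec, ← mulVec_transpose]
      simp only [dotProduct, mulVec_diagonal]
      exact Finset.sum_congr rfl fun i _ => by ring
    rw [e1, h3, e2]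
  · rw [trace_mul_comm, h3, trace_mul_comm, ← mul_assoc, h1, one_mul, trace_diagonal]
  · have e1 : (Aᵀ * A * (Aᵀ * A)).trace = ∑ i, (lam i) ^ 2 := by
      have : Aᵀ * A * (Aᵀ * A) = U * (diagonal lam * diagonal lam) * Uᵀ := by
        rw [h3]
        calc U * diagonal lam * Uᵀ * (U * diagonal lam * Uᵀ)
            = U * diagonal lam * (Uᵀ * U) * diagonal lam * Uᵀ := by simp only [mul_assoc]
          _ = _ := by rw [h1, mul_one]; simp only [mul_assoc]
      rw [this, trace_mul_comm, ← mul_assoc, h1, one_mul, diagonal_mul_diagonal, trace_diagonal]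
      simp [pow_two]
    have e2 : (Aᵀ * A * (Aᵀ * A)).trace = (A * Aᵀ * (A * Aᵀ)).trace := by
      rw [mul_assoc, trace_mul_comm]
      simp only [mul_assoc]
    rw [← e1, e2]
    have hs : ∀ i j, (A * Aᵀ) j i = (A * Aᵀ) i j := fun i j => by
      simp [mul_apply, mul_comm]
    simp only [trace, diag_apply]
    refine Finset.sum_congr rfl fun i _ => ?_
    rw [mul_apply]
    exact Finset.sum_congr rfl fun j _ => by rw [hs i j, pow_two]
  · set u : ι → ℝ := U *ᵥ (Pi.single i 1) with hu
    have hUu : Uᵀ *ᵥ u = Pi.single i 1 := by rw [hu, mulVec_mulVec, h1, one_mulVec]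
    have hev : (Aᵀ * A) *ᵥ u = lam i • u := by
      rw [h3, ← mulVec_mulVec, hUu, ← mulVec_mulVec, diagonal_mulVec_single, hu,
        ← mulVec_smul]
      congr 1
      ext j
      by_cases hj : j = i
      · subst hj; simp
      · simp [hj]
    have hu0 : u ≠ 0 := by
      intro h0
      rw [h0, mulVec_zero] at hUu
      have := congrFun hUu i
      simp at this
    by_cases hw : A *ᵥ u = 0
    · rw [← mulVec_mulVec, hw, mulVec_zero] at hev
      have : lam i = 0 := by
        rcases smul_eq_zero.1 hev.symm with h | h
        · exact h
        · exact absurd h hu0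
      rw [this, abs_zero]
      exact hb0
    · refine abs_eigenvalue_le_of_row_sum_le hb hw ?_
      calc (A * Aᵀ) *ᵥ (A *ᵥ u) = A *ᵥ ((Aᵀ * A) *ᵥ u) := by
            simp only [mulVec_mulVec, mul_assoc]
        _ = lam i • (A *ᵥ u) := by rw [hev, mulVec_smul]

end QuadraticForm

section TriangularCLT

lemma norm_prod_sub_prod_le_sum {ι : Type*} (s : Finset ι) {a b : ι → ℂ}
    (ha : ∀ i ∈ s, ‖a i‖ ≤ 1) (hb : ∀ i ∈ s, ‖b i‖ ≤ 1) :
    ‖∏ i ∈ s, a i - ∏ i ∈ s, b i‖ ≤ ∑ i ∈ s, ‖a i - b i‖ := by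
  classical
  induction s using Finset.induction_on with
  | empty => simp
  | insert j s hj ih =>
    rw [Finset.prod_insert hj, Finset.prod_insert hj, Finset.sum_insert hj]
    have ih' := ih (fun i hi => ha i (Finset.mem_insert_of_mem hi))
      (fun i hi => hb i (Finset.mem_insert_of_mem hi))
    have hbs : ‖∏ i ∈ s, a i‖ ≤ 1 := by
      rw [norm_prod]
      exact Finset.prod_le_one (fun i _ => norm_nonneg _)
        (fun i hi => ha i (Finset.mem_insert_of_mem hi))
    calc ‖a j * ∏ i ∈ s, a i - b j * ∏ i ∈ s, b i‖
        = ‖(a j - b j) * ∏ i ∈ s, a i + b j * (∏ i ∈ s, a i - ∏ i ∈ s, b i)‖ := by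
          congr 1; ring
      _ ≤ ‖a j - b j‖ * ‖∏ i ∈ s, a i‖ + ‖b j‖ * ‖∏ i ∈ s, a i - ∏ i ∈ s, b i‖ := by
          refine (norm_add_le _ _).trans ?_
          rw [norm_mul, norm_mul]
      _ ≤ ‖a j - b j‖ * 1 + 1 * ∑ i ∈ s, ‖a i - b i‖ := by
          gcongr
          exact hb j (Finset.mem_insert_self _ _)
      _ = _ := by ring

variable {P : Measure ℝ} [IsProbabilityMeasure P] {W : ℝ → ℝ}

lemma charFun_sub_exp_isLittleO (hW : Measurable W) (h0 : ∫ x, W x ∂P = 0)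
    (h1 : ∫ x, (W x) ^ 2 ∂P = 1) :
    (fun t : ℝ => charFun (P.map W) t - Complex.exp (-(t : ℂ) ^ 2 / 2))
      =o[nhds 0] fun t : ℝ => t ^ 2 := by
  have e1 := taylor_charFun_two (P := P) (X := W) hW.aemeasurable h0 h1
  have e2 : (fun t : ℝ => Complex.exp (-(t : ℂ) ^ 2 / 2) - (1 - (t : ℂ) ^ 2 / 2))
      =O[nhds 0] fun t : ℝ => t ^ 4 := by
    refine Asymptotics.IsBigO.of_bound 1 ?_
    filter_upwards [Metric.ball_mem_nhds (0 : ℝ) one_pos] with t ht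
    have ht1 : |t| < 1 := by simpa using ht
    have hle : ‖(-(t : ℂ) ^ 2 / 2)‖ ≤ 1 := by
      simp only [norm_div, norm_neg, norm_pow, Complex.norm_real, Real.norm_eq_abs, sq_abs,
        RCLike.norm_ofNat]
      nlinarith [sq_abs t, abs_nonneg t]
    have := Complex.norm_exp_sub_one_sub_id_le hle
    have e : Complex.exp (-(t : ℂ) ^ 2 / 2) - (1 - (t : ℂ) ^ 2 / 2)
        = Complex.exp (-(t : ℂ) ^ 2 / 2) - 1 - (-(t : ℂ) ^ 2 / 2) := by ring
    rw [e]
    refine this.trans ?_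
    simp only [norm_div, norm_neg, norm_pow, Complex.norm_real, Real.norm_eq_abs, sq_abs,
      RCLike.norm_ofNat, one_mul]
    have : |t| ^ 4 = (t ^ 2) ^ 2 := by rw [← sq_abs t]; ring
    rw [this]
    nlinarith [sq_nonneg (t ^ 2)]
  have e3 : (fun t : ℝ => t ^ 4) =o[nhds 0] fun t : ℝ => t ^ 2 :=
    Asymptotics.isLittleO_pow_pow (by norm_num)
  have := e1.sub (e2.trans_isLittleO e3)
  refine this.congr_left fun t => by ring

/-- Lindeberg-type central limit theorem for weighted sums of i.i.d. variables, at the level of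
characteristic functions. -/
lemma tendsto_prod_charFun (hW : Measurable W) (h0 : ∫ x, W x ∂P = 0)
    (h1 : ∫ x, (W x) ^ 2 ∂P = 1) {N : ℕ → ℕ} (u : (n : ℕ) → Fin (N n) → ℝ) {e : ℕ → ℝ}
    (hu : ∀ᶠ n in atTop, ∑ i, (u n i) ^ 2 = 1) (hue : ∀ᶠ n in atTop, ∀ i, |u n i| ≤ e n)
    (he : Tendsto e atTop (nhds 0)) (t : ℝ) :
    Tendsto (fun n => ∏ i, charFun (P.map W) (t * u n i)) atTop
      (nhds (Complex.exp (-(t : ℂ) ^ 2 / 2))) := by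
  have : IsProbabilityMeasure (P.map W) := Measure.isProbabilityMeasure_map hW.aemeasurable
  rw [tendsto_iff_norm_sub_tendsto_zero]
  rw [Metric.tendsto_atTop']
  intro ε hε
  have hlo := (charFun_sub_exp_isLittleO hW h0 h1).def (c := ε / (2 * (t ^ 2 + 1))) (by positivity)
  obtain ⟨η, hη, hball⟩ := Metric.eventually_nhds_iff.1 hlo
  have het : Tendsto (fun n => |t| * e n) atTop (nhds 0) := by
    simpa using he.const_mul |t|
  have hev := hu.and (hue.and (het.eventually (gt_mem_nhds hη)))
  obtain ⟨n0, hn0⟩ := eventually_atTop.1 hev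
  refine ⟨n0, fun n hn => ?_⟩
  obtain ⟨hs, hmax, hlt⟩ := hn0 n hn.le
  have hexp : Complex.exp (-(t : ℂ) ^ 2 / 2)
      = ∏ i, Complex.exp (-((t * u n i : ℝ) : ℂ) ^ 2 / 2) := by
    rw [← Complex.exp_sum]
    congr 1
    have : (∑ i, ((u n i : ℝ) : ℂ) ^ 2) = 1 := by exact_mod_cast congrArg Complex.ofReal hs
    calc -(t : ℂ) ^ 2 / 2 = -(t : ℂ) ^ 2 / 2 * ∑ i, ((u n i : ℝ) : ℂ) ^ 2 := by rw [this, mul_one]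
      _ = _ := by
        rw [Finset.mul_sum]
        refine Finset.sum_congr rfl fun i _ => ?_
        push_cast
        ring
  have hb : ∀ i, ‖charFun (P.map W) (t * u n i) - Complex.exp (-((t * u n i : ℝ) : ℂ) ^ 2 / 2)‖
      ≤ ε / (2 * (t ^ 2 + 1)) * (t ^ 2 * (u n i) ^ 2) := by
    intro i
    have hd : dist (t * u n i) 0 < η := by
      rw [dist_zero_right, Real.norm_eq_abs, abs_mul]
      exact (mul_le_mul_of_nonneg_left (hmax i) (abs_nonneg t)).trans_lt hlt
    have := hball hd
    rwa [Real.norm_eq_abs, abs_of_nonneg (sq_nonneg _), mul_pow] at this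
  rw [Real.dist_eq, sub_zero, abs_of_nonneg (norm_nonneg _), hexp]
  calc _ ≤ ∑ i, ‖charFun (P.map W) (t * u n i) - Complex.exp (-((t * u n i : ℝ) : ℂ) ^ 2 / 2)‖ := by
        refine norm_prod_sub_prod_le_sum _ (fun i _ => norm_charFun_le_one _) (fun i _ => ?_)
        have : (-((t * u n i : ℝ) : ℂ) ^ 2 / 2) = ((-(t * u n i) ^ 2 / 2 : ℝ) : ℂ) := by
          push_cast; ring
        rw [this, Complex.norm_exp_ofReal]
        refine Real.exp_le_one_iff.2 ?_
        nlinarith [sq_nonneg (t * u n i)]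
    _ ≤ ∑ i, ε / (2 * (t ^ 2 + 1)) * (t ^ 2 * (u n i) ^ 2) := Finset.sum_le_sum fun i _ => hb i
    _ = ε / (2 * (t ^ 2 + 1)) * t ^ 2 := by
        rw [← Finset.mul_sum, ← Finset.mul_sum, hs, mul_one]
    _ < ε := by
        rw [div_mul_eq_mul_div, div_lt_iff₀ (by positivity)]
        nlinarith [sq_nonneg t]

end TriangularCLT

section WeightedSums

variable {ι : Type*} [Fintype ι] {P : Measure ℝ} [IsProbabilityMeasure P] {W : ℝ → ℝ}

lemma memLp_weighted_sum (hW2 : MemLp W 2 P) (l : ι → ℝ) :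
    MemLp (fun x : ι → ℝ => ∑ i, l i * W (x i)) 2 (Measure.pi fun _ => P) :=
  memLp_finsetSum _ fun i _ =>
    (hW2.comp_measurePreserving (measurePreserving_eval (fun _ : ι => P) i)).const_mul (l i)

lemma integral_weighted_sum (hW2 : MemLp W 2 P) (h0 : ∫ x, W x ∂P = 0) (l : ι → ℝ) :
    ∫ x : ι → ℝ, ∑ i, l i * W (x i) ∂(Measure.pi fun _ => P) = 0 := by
  rw [integral_finsetSum]
  · refine Finset.sum_eq_zero fun i _ => ?_
    rw [integral_const_mul, integral_comp_eval (μ := fun _ : ι => P) (i := i) hW2.1, h0, mul_zero]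
  · intro i _
    exact ((hW2.comp_measurePreserving (measurePreserving_eval (fun _ : ι => P) i)).const_mul
      (l i)).integrable one_le_two

lemma integral_weighted_sum_sq (hW2 : MemLp W 2 P) (h0 : ∫ x, W x ∂P = 0)
    (h1 : ∫ x, (W x) ^ 2 ∂P = 1) (l : ι → ℝ) :
    ∫ x : ι → ℝ, (∑ i, l i * W (x i)) ^ 2 ∂(Measure.pi fun _ => P) = ∑ i, (l i) ^ 2 := by
  have hm := memLp_weighted_sum (ι := ι) hW2 l
  have e1 := variance_eq_sub hm
  rw [integral_weighted_sum hW2 h0] at e1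
  have e2 := variance_sum_pi (μ := fun _ : ι => P) (X := fun i x => l i * W x)
    (fun i => hW2.const_mul (l i))
  have e3 : (∑ i, fun x : ι → ℝ => l i * W (x i)) = fun x : ι → ℝ => ∑ i, l i * W (x i) := by
    funext x; simp
  rw [e3] at e2
  have e4 : ∀ i, Var[fun x => l i * W x; P] = (l i) ^ 2 := by
    intro i
    rw [variance_const_mul, variance_eq_sub hW2, h0]
    have : ∫ x, (W ^ 2) x ∂P = 1 := h1
    rw [this]; ring
  simp only [e4] at e2
  rw [e2] at e1
  simpa using e1.symm

lemma integral_exp_weighted_sum (hW : Measurable W) (l : ι → ℝ) (t : ℝ) :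
    ∫ x : ι → ℝ, Complex.exp (((t * ∑ i, l i * W (x i) : ℝ) : ℂ) * Complex.I)
      ∂(Measure.pi fun _ => P) = ∏ i, charFun (P.map W) (t * l i) := by
  have e : ∀ x : ι → ℝ, Complex.exp (((t * ∑ i, l i * W (x i) : ℝ) : ℂ) * Complex.I)
      = ∏ i, Complex.exp (((t * l i : ℝ) : ℂ) * (W (x i) : ℂ) * Complex.I) := by
    intro x
    rw [← Complex.exp_sum]
    congr 1
    push_cast
    rw [Finset.mul_sum, Finset.sum_mul]
    exact Finset.sum_congr rfl fun i _ => by ring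
  simp_rw [e]
  rw [integral_fintype_prod_eq_prod (μ := fun _ : ι => P)
    (f := fun i (y : ℝ) => Complex.exp (((t * l i : ℝ) : ℂ) * (W y : ℂ) * Complex.I))]
  refine Finset.prod_congr rfl fun i _ => ?_
  rw [charFun_apply_real, integral_map hW.aemeasurable (by fun_prop)]

end WeightedSums

section GaussianSquare

lemma memLp_sq_gaussianReal : MemLp (fun x : ℝ => x ^ 2) 2 (gaussianReal 0 1) := by
  refine (memLp_two_iff_integrable_sq (by fun_prop)).2 ?_
  have := (memLp_id_gaussianReal' (μ := 0) (v := 1) 4 (by norm_num)).integrable_norm_pow'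
  refine this.congr (Eventually.of_forall fun x => ?_)
  simp only [id, Real.norm_eq_abs]
  have : |x| ^ 4 = (x ^ 2) ^ 2 := by rw [← sq_abs x]; ring
  exact_mod_cast this

lemma integral_sq_gaussianReal : ∫ x, x ^ 2 ∂(gaussianReal 0 1) = 1 := by
  have h := variance_eq_sub (memLp_id_gaussianReal (μ := 0) (v := 1) 2)
  rw [variance_id_gaussianReal] at h
  simpa using h.symm

lemma variance_sq_gaussianReal_pos : 0 < Var[fun x : ℝ => x ^ 2; gaussianReal 0 1] := by
  refine lt_of_le_of_ne (variance_nonneg _ _) fun h => ?_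
  have h0 := ae_eq_integral_of_variance_eq_zero memLp_sq_gaussianReal h.symm
  rw [integral_sq_gaussianReal] at h0
  have : NullSingletonClass (gaussianReal 0 1) := nullSingletonClass_gaussianReal one_ne_zero
  have h2 : ∀ᵐ x ∂(gaussianReal 0 1), x ∉ ({1, -1} : Set ℝ) :=
    (measure_eq_zero_iff_ae_notMem).1 (Set.Finite.measure_zero (by simp) _)
  have : ∀ᵐ x ∂(gaussianReal 0 1), False := by
    filter_upwards [h0, h2] with x hx1 hx2
    apply hx2
    have hx1' : x ^ 2 = 1 := hx1
    rcases (sq_eq_sq_iff_eq_or_eq_neg.1 (hx1'.trans (one_pow 2).symm)) with h | h <;> simp [h]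
  have := this.exists
  simp at this

end GaussianSquare

section GaussianQuadraticCLT

/-- Variance of the square of a standard normal variable. -/
noncomputable def chiSqVar : ℝ := Var[fun x : ℝ => x ^ 2; gaussianReal 0 1]

/-- Standardization of the square of a standard normal variable. -/
noncomputable def chiSqStd (x : ℝ) : ℝ := (x ^ 2 - 1) / Real.sqrt chiSqVar

lemma chiSqVar_pos : 0 < chiSqVar := variance_sq_gaussianReal_pos

lemma measurable_chiSqStd : Measurable chiSqStd := by
  unfold chiSqStd; fun_prop

lemma memLp_chiSqStd : MemLp chiSqStd 2 (gaussianReal 0 1) := by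
  have := (memLp_sq_gaussianReal.sub (memLp_const (1 : ℝ))).const_mul (Real.sqrt chiSqVar)⁻¹
  refine this.ae_eq (Eventually.of_forall fun x => ?_)
  simp [chiSqStd, div_eq_inv_mul]

lemma integral_chiSqStd : ∫ x, chiSqStd x ∂(gaussianReal 0 1) = 0 := by
  unfold chiSqStd
  rw [integral_div, integral_sub (memLp_sq_gaussianReal.integrable one_le_two)
    (integrable_const _), integral_sq_gaussianReal]
  simp

lemma integral_chiSqStd_sq : ∫ x, (chiSqStd x) ^ 2 ∂(gaussianReal 0 1) = 1 := by
  have h : ∀ x, (chiSqStd x) ^ 2 = (x ^ 2 - 1) ^ 2 / chiSqVar := fun x => by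
    rw [chiSqStd, div_pow, Real.sq_sqrt chiSqVar_pos.le]
  simp_rw [h]
  rw [integral_div]
  have : ∫ x : ℝ, (x ^ 2 - 1) ^ 2 ∂(gaussianReal 0 1) = chiSqVar := by
    rw [chiSqVar, variance_eq_integral (by fun_prop), integral_sq_gaussianReal]
  rw [this, div_self chiSqVar_pos.ne']

variable {ι : Type*} [Fintype ι]

lemma sum_mul_sq_eq_chiSqStd (lam y : ι → ℝ) :
    ∑ i, lam i * (y i) ^ 2
      = ∑ i, lam i + Real.sqrt chiSqVar * ∑ i, lam i * chiSqStd (y i) := by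
  have h : Real.sqrt chiSqVar ≠ 0 := (Real.sqrt_pos.2 chiSqVar_pos).ne'
  rw [Finset.mul_sum, ← Finset.sum_add_distrib]
  refine Finset.sum_congr rfl fun i _ => ?_
  rw [chiSqStd]
  field_simp
  ring

lemma integral_comp_measurePreserving {α E : Type*} [MeasurableSpace α] [NormedAddCommGroup E]
    [NormedSpace ℝ E] {μ : Measure α} {T : α → α} (hT : MeasurePreserving T μ μ) {g : α → E}
    (hg : AEStronglyMeasurable g μ) : ∫ x, g (T x) ∂μ = ∫ x, g x ∂μ := by
  conv_rhs => rw [← hT.map_eq]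
  rw [integral_map hT.measurable.aemeasurable (by rwa [hT.map_eq])]

variable [DecidableEq ι]

lemma integral_sum_sq_mulVec (A : Matrix ι ι ℝ) :
    ∫ x : ι → ℝ, ∑ i, ((A *ᵥ x) i) ^ 2 ∂(Measure.pi fun _ => gaussianReal 0 1)
      = (A * Aᵀ).trace := by
  obtain ⟨T, lam, hT, h1, h2, -, -⟩ := exists_gaussian_quadratic_diag A
  have hm := memLp_weighted_sum memLp_chiSqStd lam
  simp_rw [h1, sum_mul_sq_eq_chiSqStd]
  rw [integral_comp_measurePreserving (g := fun y : ι → ℝ => ∑ i, lam i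
    + Real.sqrt chiSqVar * ∑ i, lam i * chiSqStd (y i)) hT
    (aestronglyMeasurable_const.add (hm.1.const_mul _)),
    integral_add (integrable_const _) ((hm.integrable one_le_two).const_mul _),
    integral_const_mul, integral_weighted_sum memLp_chiSqStd integral_chiSqStd]
  simp [h2]

lemma integral_sum_sq_mulVec_sub_sq (A : Matrix ι ι ℝ) :
    ∫ x : ι → ℝ, (∑ i, ((A *ᵥ x) i) ^ 2 - (A * Aᵀ).trace) ^ 2
        ∂(Measure.pi fun _ => gaussianReal 0 1)
      = chiSqVar * ∑ i, ∑ j, ((A * Aᵀ) i j) ^ 2 := by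
  obtain ⟨T, lam, hT, h1, h2, h3, -⟩ := exists_gaussian_quadratic_diag A
  have hm := memLp_weighted_sum memLp_chiSqStd lam
  simp_rw [h1, ← h2, sum_mul_sq_eq_chiSqStd, add_sub_cancel_left, mul_pow,
    Real.sq_sqrt chiSqVar_pos.le]
  rw [integral_const_mul, integral_comp_measurePreserving
    (g := fun y : ι → ℝ => (∑ i, lam i * chiSqStd (y i)) ^ 2) hT (hm.1.pow 2),
    integral_weighted_sum_sq memLp_chiSqStd integral_chiSqStd integral_chiSqStd_sq, h3]

omit [DecidableEq ι] in
lemma memLp_linear_gaussian (v : ι → ℝ) :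
    MemLp (fun x : ι → ℝ => ∑ i, v i * x i) 2 (Measure.pi fun _ => gaussianReal 0 1) :=
  memLp_weighted_sum (W := id) (memLp_id_gaussianReal 2) v

omit [DecidableEq ι] in
lemma integral_linear_gaussian_sq (v : ι → ℝ) :
    ∫ x : ι → ℝ, (∑ i, v i * x i) ^ 2 ∂(Measure.pi fun _ => gaussianReal 0 1)
      = ∑ i, (v i) ^ 2 :=
  integral_weighted_sum_sq (W := id) (memLp_id_gaussianReal 2) (by simp)
    integral_sq_gaussianReal v

omit [DecidableEq ι] in
lemma dotProduct_mulVec_eq (A : Matrix ι ι ℝ) (m x : ι → ℝ) :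
    ∑ i, m i * (A *ᵥ x) i = ∑ i, (Aᵀ *ᵥ m) i * x i := by
  have := dotProduct_mulVec m A x
  rw [← mulVec_transpose] at this
  exact this

omit [DecidableEq ι] in
/-- The variance of `m·(A G)` is at most `|m|²` times the Frobenius norm of `A Aᵀ`. -/
lemma sum_sq_transpose_mulVec_le (A : Matrix ι ι ℝ) (m : ι → ℝ) :
    ∑ i, ((Aᵀ *ᵥ m) i) ^ 2
      ≤ (∑ i, (m i) ^ 2) * Real.sqrt (∑ i, ∑ j, ((A * Aᵀ) i j) ^ 2) := by
  have e1 : ∑ i, ((Aᵀ *ᵥ m) i) ^ 2 = ∑ i, m i * ((A * Aᵀ) *ᵥ m) i := by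
    rw [← mulVec_mulVec, dotProduct_mulVec_eq]
    exact Finset.sum_congr rfl fun i _ => pow_two _
  have e2 : ∑ i, m i * ((A * Aᵀ) *ᵥ m) i
      = ∑ p : ι × ι, (m p.1 * m p.2) * (A * Aᵀ) p.1 p.2 := by
    rw [Fintype.sum_prod_type]
    refine Finset.sum_congr rfl fun i _ => ?_
    simp only [mulVec, dotProduct, Finset.mul_sum]
    exact Finset.sum_congr rfl fun j _ => by ring
  rw [e1, e2]
  refine (Real.sum_mul_le_sqrt_mul_sqrt _ _ _).trans (le_of_eq ?_)
  have e3 : ∑ p : ι × ι, (m p.1 * m p.2) ^ 2 = (∑ i, (m i) ^ 2) ^ 2 := by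
    rw [Fintype.sum_prod_type, pow_two, Finset.sum_mul_sum]
    exact Finset.sum_congr rfl fun i _ => Finset.sum_congr rfl fun j _ => by ring
  rw [e3, Real.sqrt_sq (Finset.sum_nonneg fun i _ => sq_nonneg _), Fintype.sum_prod_type]

omit [DecidableEq ι] in
lemma integral_abs_linear_gaussian_le (v : ι → ℝ) :
    ∫ x : ι → ℝ, |∑ i, v i * x i| ∂(Measure.pi fun _ => gaussianReal 0 1)
      ≤ Real.sqrt (∑ i, (v i) ^ 2) := by
  have hm : MemLp (fun x : ι → ℝ => |∑ i, v i * x i|) 2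
      (Measure.pi fun _ => gaussianReal 0 1) := (memLp_linear_gaussian v).abs
  have h := variance_nonneg (fun x : ι → ℝ => |∑ i, v i * x i|)
    (Measure.pi fun _ => gaussianReal 0 1)
  rw [variance_eq_sub hm] at h
  refine Real.le_sqrt_of_sq_le ?_
  rw [← integral_linear_gaussian_sq]
  simp only [Pi.pow_apply, sq_abs] at h
  linarith

lemma norm_integral_exp_sub_le {α : Type*} [MeasurableSpace α] {μ : Measure α}
    [IsProbabilityMeasure μ] {Y T : α → ℝ} (hY : AEStronglyMeasurable Y μ)
    (hT : AEStronglyMeasurable T μ) (hi : Integrable (fun x => Y x - T x) μ) (t : ℝ) :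
    ‖∫ x, Complex.exp (((t * Y x : ℝ) : ℂ) * Complex.I) ∂μ
        - ∫ x, Complex.exp (((t * T x : ℝ) : ℂ) * Complex.I) ∂μ‖
      ≤ |t| * ∫ x, |Y x - T x| ∂μ := by
  have hint : ∀ {Z : α → ℝ}, AEStronglyMeasurable Z μ →
      Integrable (fun x => Complex.exp (((t * Z x : ℝ) : ℂ) * Complex.I)) μ := by
    intro Z hZ
    refine Integrable.of_bound (C := 1) ?_ (Eventually.of_forall fun x => ?_)
    · have hc : Continuous fun y : ℝ => Complex.exp (((t * y : ℝ) : ℂ) * Complex.I) := by fun_prop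
      exact hc.comp_aestronglyMeasurable hZ
    · rw [Complex.norm_exp_ofReal_mul_I]
  rw [← integral_sub (hint hY) (hint hT), ← integral_const_mul]
  refine norm_integral_le_of_norm_le (hi.abs.const_mul _) (Eventually.of_forall fun x => ?_)
  have e : Complex.exp (((t * Y x : ℝ) : ℂ) * Complex.I)
      - Complex.exp (((t * T x : ℝ) : ℂ) * Complex.I)
      = Complex.exp (((t * T x : ℝ) : ℂ) * Complex.I)
        * (Complex.exp (Complex.I * ((t * (Y x - T x) : ℝ) : ℂ)) - 1) := by
    rw [mul_sub, ← Complex.exp_add, mul_one]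
    congr 2
    push_cast
    ring
  rw [e, norm_mul, Complex.norm_exp_ofReal_mul_I, one_mul]
  refine Real.norm_exp_I_mul_ofReal_sub_one_le.trans (le_of_eq ?_)
  rw [Real.norm_eq_abs, abs_mul]

/-- Characteristic function of a standardized Gaussian quadratic form with a drift, compared with
the product form of the characteristic function of a weighted chi-square sum. -/
lemma exists_charFun_quadratic_bound (A : Matrix ι ι ℝ) (m : ι → ℝ) (c b F : ℝ) (hb0 : 0 ≤ b)
    (hb : ∀ i, ∑ j, |(A * Aᵀ) i j| ≤ b)
    (hF : F = Real.sqrt (∑ i, ∑ j, ((A * Aᵀ) i j) ^ 2)) (hFpos : 0 < F) :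
    ∃ u : ι → ℝ, ∑ i, (u i) ^ 2 = 1 ∧ (∀ i, |u i| ≤ b / F) ∧ ∀ t : ℝ,
      ‖∫ x : ι → ℝ, Complex.exp (((t * ((∑ i, (m i + (A *ᵥ x) i) ^ 2 - c)
            / (Real.sqrt chiSqVar * F)) : ℝ) : ℂ) * Complex.I)
            ∂(Measure.pi fun _ => gaussianReal 0 1)
          - ∏ i, charFun ((gaussianReal 0 1).map chiSqStd) (t * u i)‖
        ≤ |t| * ((|((A * Aᵀ).trace - c) / F| + (∑ i, (m i) ^ 2) / F
            + 2 * Real.sqrt ((∑ i, (m i) ^ 2) / F)) / Real.sqrt chiSqVar) := by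
  obtain ⟨T, lam, hT, h1, h2, h3, h4⟩ := exists_gaussian_quadratic_diag A
  have hκ : 0 < Real.sqrt chiSqVar := Real.sqrt_pos.2 chiSqVar_pos
  have hF2 : ∑ i, (lam i) ^ 2 = F ^ 2 := by
    rw [h3, hF, Real.sq_sqrt]
    exact Finset.sum_nonneg fun i _ => Finset.sum_nonneg fun j _ => sq_nonneg _
  refine ⟨fun i => lam i / F, ?_, fun i => ?_, fun t => ?_⟩
  · simp_rw [div_pow]
    rw [← Finset.sum_div, hF2, div_self (by positivity)]
  · rw [abs_div, abs_of_pos hFpos]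
    exact div_le_div_of_nonneg_right (h4 b hb0 hb i) hFpos.le
  set ν : Measure (ι → ℝ) := Measure.pi fun _ => gaussianReal 0 1 with hν
  set Y : (ι → ℝ) → ℝ := fun x =>
    (∑ i, (m i + (A *ᵥ x) i) ^ 2 - c) / (Real.sqrt chiSqVar * F) with hY
  set S : (ι → ℝ) → ℝ := fun x => ∑ i, lam i / F * chiSqStd (T x i) with hS
  have hmS := memLp_weighted_sum memLp_chiSqStd (fun i => lam i / F)
  have hprod : ∏ i, charFun ((gaussianReal 0 1).map chiSqStd) (t * (lam i / F))
      = ∫ x, Complex.exp (((t * S x : ℝ) : ℂ) * Complex.I) ∂ν := by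
    have hc : Continuous fun y : ℝ => Complex.exp (((t * y : ℝ) : ℂ) * Complex.I) := by fun_prop
    rw [← integral_exp_weighted_sum measurable_chiSqStd, hS, hν,
      integral_comp_measurePreserving (g := fun y : ι → ℝ =>
        Complex.exp (((t * ∑ i, lam i / F * chiSqStd (y i) : ℝ) : ℂ) * Complex.I)) hT
        (hc.comp_aestronglyMeasurable hmS.1)]
  have hdiff : ∀ x, Y x - S x = (((A * Aᵀ).trace - c) / F + (∑ i, (m i) ^ 2) / F
      + 2 / F * ∑ i, (Aᵀ *ᵥ m) i * x i) / Real.sqrt chiSqVar := by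
    intro x
    have e1 : ∑ i, (m i + (A *ᵥ x) i) ^ 2
        = ∑ i, (m i) ^ 2 + 2 * ∑ i, (Aᵀ *ᵥ m) i * x i + ∑ i, ((A *ᵥ x) i) ^ 2 := by
      rw [← dotProduct_mulVec_eq, Finset.mul_sum, ← Finset.sum_add_distrib,
        ← Finset.sum_add_distrib]
      exact Finset.sum_congr rfl fun i _ => by ring
    have e2 : S x = (∑ i, lam i * chiSqStd (T x i)) / F := by
      rw [hS, Finset.sum_div]
      exact Finset.sum_congr rfl fun i _ => by ring
    rw [e2, hY]
    simp only
    rw [e1, h1, sum_mul_sq_eq_chiSqStd, h2]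
    field_simp
    ring
  have hlin := memLp_linear_gaussian (Aᵀ *ᵥ m)
  have hYm : AEStronglyMeasurable Y ν := by
    have : Continuous Y := by
      rw [hY]
      simp only [mulVec, dotProduct]
      fun_prop
    exact this.aestronglyMeasurable
  have hSm : AEStronglyMeasurable S ν := hmS.1.comp_measurePreserving hT
  have hlini := (hlin.integrable one_le_two).const_mul (2 / F)
  have hi : Integrable (fun x => Y x - S x) ν := by
    simp_rw [hdiff]
    exact ((integrable_const _).add hlini).div_const _
  rw [hprod]
  refine (norm_integral_exp_sub_le hYm hSm hi t).trans ?_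
  refine mul_le_mul_of_nonneg_left ?_ (abs_nonneg t)
  have hM0 : 0 ≤ ∑ i, (m i) ^ 2 := Finset.sum_nonneg fun i _ => sq_nonneg _
  have hlinb : ∫ x : ι → ℝ, 2 / F * |∑ i, (Aᵀ *ᵥ m) i * x i| ∂ν
      ≤ 2 * Real.sqrt ((∑ i, (m i) ^ 2) / F) := by
    rw [integral_const_mul, div_mul_eq_mul_div, mul_div_assoc]
    refine mul_le_mul_of_nonneg_left ?_ zero_le_two
    refine (div_le_div_of_nonneg_right (integral_abs_linear_gaussian_le _) hFpos.le).trans ?_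
    rw [div_le_iff₀ hFpos]
    refine Real.sqrt_le_iff.2 ⟨by positivity, ?_⟩
    rw [mul_pow, Real.sq_sqrt (by positivity)]
    refine (sum_sq_transpose_mulVec_le A m).trans (le_of_eq ?_)
    rw [← hF]
    field_simp
  calc ∫ x, |Y x - S x| ∂ν
      ≤ ∫ x, (|((A * Aᵀ).trace - c) / F| + (∑ i, (m i) ^ 2) / F
          + 2 / F * |∑ i, (Aᵀ *ᵥ m) i * x i|) / Real.sqrt chiSqVar ∂ν := by
        refine integral_mono hi.abs
          (((integrable_const _).add (((hlin.integrable one_le_two).abs).const_mul _)).div_const _)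
          fun x => ?_
        simp only
        rw [hdiff, abs_div, abs_of_pos hκ]
        refine div_le_div_of_nonneg_right ?_ hκ.le
        refine (abs_add_le _ _).trans (add_le_add ((abs_add_le _ _).trans (add_le_add le_rfl ?_)) ?_)
        · rw [abs_of_nonneg (by positivity)]
        · rw [abs_mul, abs_of_pos (by positivity : (0 : ℝ) < 2 / F)]
    _ = (|((A * Aᵀ).trace - c) / F| + (∑ i, (m i) ^ 2) / F
          + ∫ x, 2 / F * |∑ i, (Aᵀ *ᵥ m) i * x i| ∂ν) / Real.sqrt chiSqVar := by
        rw [integral_div, integral_add (integrable_const _)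
          (((hlin.integrable one_le_two).abs).const_mul _)]
        simp [hν]
    _ ≤ _ := by gcongr

end GaussianQuadraticCLT

section DriftedCLT

lemma measurable_mulVec {m : ℕ} (A : Matrix (Fin m) (Fin m) ℝ) : Measurable A.mulVec := by
  have : Continuous A.mulVec := continuous_pi fun i =>
    show Continuous fun x : Fin m → ℝ => ∑ j, A i j * x j by fun_prop
  exact this.measurable

variable (L : ℕ) (A : (n : ℕ) → Matrix (Fin (n - L + 1)) (Fin (n - L + 1)) ℝ)

lemma isProbabilityMeasure_gaussVec (n : ℕ) : IsProbabilityMeasure (gaussVec L A n) :=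
  Measure.isProbabilityMeasure_map (measurable_mulVec _).aemeasurable

lemma measurable_quadVar (m : ℕ) : Measurable (quadVar m) := by
  unfold quadVar; fun_prop

lemma expV_eq_trace (n : ℕ) : expV L A n = (A n * (A n)ᵀ).trace := by
  rw [expV, gaussVec, integral_map (measurable_mulVec _).aemeasurable
    (measurable_quadVar _).aestronglyMeasurable, ← integral_sum_sq_mulVec]
  rfl

lemma varV_eq (n : ℕ) :
    varV L A n = chiSqVar * ∑ i, ∑ j, ((A n * (A n)ᵀ) i j) ^ 2 := by
  rw [varV, gaussVec, integral_map (measurable_mulVec _).aemeasurable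
    (((measurable_quadVar _).sub_const _).pow_const 2).aestronglyMeasurable, expV_eq_trace,
    ← integral_sum_sq_mulVec_sub_sq]
  rfl

/-- Central limit theorem for standardized quadratic forms of Gaussian vectors with a drift. -/
theorem tendsto_integral_drifted_quadVar (m : (n : ℕ) → Fin (n - L + 1) → ℝ) (d b F : ℕ → ℝ)
    (C : ℝ) (hF : ∀ n, F n = Real.sqrt (∑ i, ∑ j, ((A n * (A n)ᵀ) i j) ^ 2))
    (hFpos : ∀ᶠ n in atTop, 0 < F n) (hd : ∀ᶠ n in atTop, 0 < d n) (hb0 : ∀ᶠ n in atTop, 0 ≤ b n)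
    (hb : ∀ᶠ n in atTop, ∀ i, ∑ j, |(A n * (A n)ᵀ) i j| ≤ b n)
    (hbF : Tendsto (fun n => b n / F n) atTop (nhds 0))
    (hE : Tendsto (fun n => ((A n * (A n)ᵀ).trace - C * d n) / F n) atTop (nhds 0))
    (hm : Tendsto (fun n => (∑ i, (m n i) ^ 2) / F n) atTop (nhds 0))
    (g : BoundedContinuousFunction ℝ ℝ) :
    Tendsto (fun n : ℕ => ∫ z, g (((∑ i, (m n i + z i) ^ 2) / d n - C)
          / Real.sqrt (varV L A n / (d n) ^ 2)) ∂(gaussVec L A n))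
      atTop (nhds (∫ x, g x ∂(gaussianReal 0 1))) := by
  set ψ : (n : ℕ) → (Fin (n - L + 1) → ℝ) → ℝ := fun n z =>
    ((∑ i, (m n i + z i) ^ 2) / d n - C) / Real.sqrt (varV L A n / (d n) ^ 2) with hψ
  have hψc : ∀ n, Continuous (ψ n) := fun n => by
    rw [hψ]; fun_prop
  have hprob := isProbabilityMeasure_gaussVec L A
  have hκ : 0 < Real.sqrt chiSqVar := Real.sqrt_pos.2 chiSqVar_pos
  let μs : ℕ → ProbabilityMeasure ℝ := fun n => ⟨(gaussVec L A n).map (ψ n),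
    Measure.isProbabilityMeasure_map (hψc n).measurable.aemeasurable⟩
  let μ0 : ProbabilityMeasure ℝ := ⟨gaussianReal 0 1, inferInstance⟩
  have hchar : ∀ t : ℝ, Tendsto (fun n => charFun (μs n : Measure ℝ) t) atTop
      (nhds (charFun (μ0 : Measure ℝ) t)) := by
    intro t
    have e0 : charFun (μ0 : Measure ℝ) t = Complex.exp (-(t : ℂ) ^ 2 / 2) := by
      change charFun (gaussianReal 0 1) t = _
      rw [charFun_gaussianReal]
      congr 1
      simp
      ring
    rw [e0]
    have hex : ∀ n, ∃ u : Fin (n - L + 1) → ℝ, (0 < F n → 0 < d n → 0 ≤ b n →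
        (∀ i, ∑ j, |(A n * (A n)ᵀ) i j| ≤ b n) →
        ∑ i, (u i) ^ 2 = 1 ∧ (∀ i, |u i| ≤ b n / F n) ∧
        ‖charFun (μs n : Measure ℝ) t
            - ∏ i, charFun ((gaussianReal 0 1).map chiSqStd) (t * u i)‖
        ≤ |t| * ((|((A n * (A n)ᵀ).trace - C * d n) / F n| + (∑ i, (m n i) ^ 2) / F n
            + 2 * Real.sqrt ((∑ i, (m n i) ^ 2) / F n)) / Real.sqrt chiSqVar)) := by
      intro n
      by_cases hc : 0 < F n ∧ 0 < d n ∧ 0 ≤ b n ∧ ∀ i, ∑ j, |(A n * (A n)ᵀ) i j| ≤ b n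
      · obtain ⟨c1, c2, c3, c4⟩ := hc
        obtain ⟨u, hu1, hu2, hu3⟩ := exists_charFun_quadratic_bound (A n) (m n) (C * d n) (b n)
          (F n) c3 c4 (hF n) c1
        refine ⟨u, fun _ _ _ _ => ⟨hu1, hu2, ?_⟩⟩
        have hch : charFun (μs n : Measure ℝ) t
            = ∫ x, Complex.exp (((t * ((∑ i, (m n i + (A n *ᵥ x) i) ^ 2 - C * d n)
            / (Real.sqrt chiSqVar * F n)) : ℝ) : ℂ) * Complex.I)
            ∂(Measure.pi fun _ => gaussianReal 0 1) := by
          change charFun ((gaussVec L A n).map (ψ n)) t = _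
          rw [gaussVec, Measure.map_map (hψc n).measurable (measurable_mulVec _),
            charFun_apply_real, integral_map
              ((hψc n).measurable.comp (measurable_mulVec _)).aemeasurable (by fun_prop)]
          refine integral_congr_ae (Eventually.of_forall fun x => ?_)
          have hsq : Real.sqrt (varV L A n / (d n) ^ 2) = Real.sqrt chiSqVar * F n / d n := by
            have hnn : 0 ≤ chiSqVar * ∑ i, ∑ j, ((A n * (A n)ᵀ) i j) ^ 2 :=
              mul_nonneg chiSqVar_pos.le
                (Finset.sum_nonneg fun i _ => Finset.sum_nonneg fun j _ => sq_nonneg _)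
            rw [varV_eq, Real.sqrt_div hnn, Real.sqrt_sq c2.le, Real.sqrt_mul chiSqVar_pos.le, hF]
          have : ψ n (A n *ᵥ x) = (∑ i, (m n i + (A n *ᵥ x) i) ^ 2 - C * d n)
              / (Real.sqrt chiSqVar * F n) := by
            rw [hψ]
            simp only
            rw [hsq]
            field_simp
          simp only [Function.comp_apply, this, Complex.ofReal_mul]
        rw [hch]
        exact hu3 t
      · exact ⟨0, fun h1 h2 h3 h4 => absurd ⟨h1, h2, h3, h4⟩ hc⟩
    choose u hu using hex
    have hall : ∀ᶠ n in atTop, ∑ i, (u n i) ^ 2 = 1 ∧ (∀ i, |u n i| ≤ b n / F n) ∧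
        ‖charFun (μs n : Measure ℝ) t
            - ∏ i, charFun ((gaussianReal 0 1).map chiSqStd) (t * u n i)‖
        ≤ |t| * ((|((A n * (A n)ᵀ).trace - C * d n) / F n| + (∑ i, (m n i) ^ 2) / F n
            + 2 * Real.sqrt ((∑ i, (m n i) ^ 2) / F n)) / Real.sqrt chiSqVar) := by
      filter_upwards [hFpos, hd, hb0, hb] with n a1 a2 a3 a4 using hu n a1 a2 a3 a4
    have hlim := tendsto_prod_charFun measurable_chiSqStd integral_chiSqStd integral_chiSqStd_sq u
      (hall.mono fun n h => h.1) (hall.mono fun n h => h.2.1) hbF t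
    have hzero : Tendsto (fun n => charFun (μs n : Measure ℝ) t
        - ∏ i, charFun ((gaussianReal 0 1).map chiSqStd) (t * u n i)) atTop (nhds 0) := by
      refine squeeze_zero_norm' (hall.mono fun n h => h.2.2) ?_
      have := (((hE.abs.add hm).add ((hm.sqrt).const_mul 2)).div_const
        (Real.sqrt chiSqVar)).const_mul |t|
      simpa using this
    simpa using hzero.add hlim
  have hconv := ProbabilityMeasure.tendsto_of_tendsto_charFun hchar
  rw [ProbabilityMeasure.tendsto_iff_forall_integral_tendsto] at hconv
  refine (hconv g).congr fun n => ?_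
  change ∫ ω, g ω ∂((gaussVec L A n).map (ψ n)) = _
  rw [integral_map (hψc n).measurable.aemeasurable g.continuous.aestronglyMeasurable]

end DriftedCLT

section VariationSequence

variable {a : ℤ → ℝ} {L : ℕ} (hsupp : ∀ j : ℤ, a j ≠ 0 → 0 ≤ j ∧ j ≤ (L : ℤ) - 1)

include hsupp

lemma support_subset_image_range (F : ℤ → ℝ) :
    Function.support (fun j => a j * F j)
      ⊆ ((Finset.range L).map Nat.castEmbedding : Finset ℤ) := by
  intro j hj
  obtain ⟨h0, h1⟩ := hsupp j (left_ne_zero_of_mul hj)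
  simp only [Finset.coe_map, Set.mem_image, Finset.mem_coe, Finset.mem_range]
  exact ⟨j.toNat, by omega, by simp [h0]⟩

lemma finsum_mul_eq_sum_range (F : ℤ → ℝ) :
    ∑ᶠ j : ℤ, a j * F j = ∑ j ∈ Finset.range L, a j * F j := by
  rw [finsum_eq_sum_of_support_subset _ (support_subset_image_range hsupp F), Finset.sum_map]
  rfl

lemma finsum_seqConv_mul (G : ℤ → ℝ) :
    ∑ᶠ m : ℤ, seqConv a a m * G m
      = ∑ j ∈ Finset.range L, ∑ l ∈ Finset.range L, a j * a l * G ((j : ℤ) - l) := by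
  have h1 : ∀ m : ℤ, seqConv a a m * G m
      = ∑ j ∈ Finset.range L, a j * (a ((j : ℤ) - m) * G m) := fun m => by
    rw [seqConv, finsum_mul_eq_sum_range hsupp, Finset.sum_mul]
    exact Finset.sum_congr rfl fun j _ => by ring
  simp_rw [h1]
  have hshift : ∀ j : ℤ, ∀ m : ℤ, a (j - m) * G m
      = (fun l => a l * G (j - l)) (Equiv.subLeft j m) := fun j m => by
    simp [Equiv.subLeft]
  have hfin : ∀ j : ℤ, (Function.support fun m => a (j - m) * G m).Finite := fun j => by
    have := ((Finset.finite_toSet _).subset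
      (support_subset_image_range hsupp fun l => G (j - l))).preimage
        (Equiv.subLeft j).injective.injOn
    refine this.subset fun m hm => ?_
    have hm' : a (j - m) * G m ≠ 0 := hm
    rw [hshift] at hm'
    exact hm'
  rw [finsum_sum_comm]
  · refine Finset.sum_congr rfl fun j _ => ?_
    rw [← mul_finsum]
    simp_rw [hshift j]
    rw [finsum_comp_equiv (Equiv.subLeft (j : ℤ)) (f := fun l => a l * G (j - l)),
      finsum_mul_eq_sum_range hsupp, Finset.mul_sum]
    exact Finset.sum_congr rfl fun l _ => by ring
  · intro j _
    refine (hfin j).subset fun m hm => ?_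
    exact right_ne_zero_of_mul hm

end VariationSequence

section Moments

variable {a : ℤ → ℝ} {L M : ℕ}

lemma sum_moment_sub_eq_zero (hm : ∀ k < M, ∑ j ∈ Finset.range L, a j * (j : ℝ) ^ k = 0) {p : ℕ}
    (hp : p < 2 * M) :
    ∑ j ∈ Finset.range L, ∑ l ∈ Finset.range L, a j * a l * ((j : ℝ) - l) ^ p = 0 := by
  have h : ∀ j l : ℕ, a j * a l * ((j : ℝ) - l) ^ p = ∑ k ∈ Finset.range (p + 1),
      ((-1) ^ (p - k) * (p.choose k : ℝ)) * ((a j * (j : ℝ) ^ k) * (a l * (l : ℝ) ^ (p - k))) := by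
    intro j l
    rw [sub_eq_add_neg, add_pow, Finset.mul_sum]
    refine Finset.sum_congr rfl fun k _ => ?_
    rw [neg_pow (l : ℝ)]
    ring
  simp_rw [h]
  have h2 : ∀ j ∈ Finset.range L, ∑ l ∈ Finset.range L, ∑ k ∈ Finset.range (p + 1),
      ((-1) ^ (p - k) * (p.choose k : ℝ)) * ((a j * (j : ℝ) ^ k) * (a l * (l : ℝ) ^ (p - k)))
      = ∑ k ∈ Finset.range (p + 1), ((-1) ^ (p - k) * (p.choose k : ℝ)) * ((a j * (j : ℝ) ^ k) *
        ∑ l ∈ Finset.range L, (a l * (l : ℝ) ^ (p - k))) := by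
    intro j _
    rw [Finset.sum_comm]
    refine Finset.sum_congr rfl fun k _ => ?_
    rw [Finset.mul_sum, Finset.mul_sum]
  rw [Finset.sum_congr rfl h2, Finset.sum_comm]
  refine Finset.sum_eq_zero fun k hk => ?_
  rw [Finset.mem_range] at hk
  by_cases hkM : k < M
  · rw [← Finset.mul_sum, ← Finset.sum_mul, hm k hkM]
    ring
  · rw [hm (p - k) (by omega)]
    simp

end Moments

section Taylor

/-- Taylor's formula with Lagrange remainder on the half-line. -/
lemma exists_taylor_lagrange_Ioi {φ : ℝ → ℝ} {q : ℕ} (hq : 1 ≤ q)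
    (hφ : ContDiffOn ℝ q φ (Set.Ioi 0)) {x₀ x : ℝ} (hx₀ : 0 < x₀) (hx : 0 < x) :
    ∃ ξ ∈ Set.uIcc x₀ x, φ x = ∑ k ∈ Finset.range q,
        iteratedDeriv k φ x₀ / (k.factorial : ℝ) * (x - x₀) ^ k
      + iteratedDeriv q φ ξ / (q.factorial : ℝ) * (x - x₀) ^ q := by
  obtain ⟨n, rfl⟩ : ∃ n, q = n + 1 := ⟨q - 1, by omega⟩
  by_cases hne : x₀ = x
  · subst hne
    refine ⟨x₀, Set.left_mem_uIcc, ?_⟩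
    rw [Finset.sum_range_succ']
    simp
  have hsub : Set.uIcc x₀ x ⊆ Set.Ioi 0 := fun y hy => (lt_min hx₀ hx).trans_le hy.1
  have hc := hφ.mono hsub
  obtain ⟨ξ, hξ, he⟩ := taylor_mean_remainder_lagrange_iteratedDeriv hne (by exact_mod_cast hc)
  refine ⟨ξ, Set.uIoo_subset_uIcc_self hξ, ?_⟩
  have hu : UniqueDiffOn ℝ (Set.uIcc x₀ x) := uniqueDiffOn_Icc (min_lt_max.2 hne)
  rw [sub_eq_iff_eq_add'] at he
  rw [he, taylor_within_apply]
  congr 1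
  · refine Finset.sum_congr rfl fun k hk => ?_
    have hk' : k < n + 1 := Finset.mem_range.1 hk
    rw [iteratedDerivWithin_eq_iteratedDeriv hu
      ((hφ.contDiffAt (Ioi_mem_nhds hx₀)).of_le (by exact_mod_cast hk'.le)) Set.left_mem_uIcc,
      smul_eq_mul]
    field_simp
  · field_simp

end Taylor

section Drift

variable {a : ℤ → ℝ} {L M : ℕ} {f : ℝ → ℝ}

lemma abs_driftDiff_le (hsupp : ∀ j : ℤ, a j ≠ 0 → 0 ≤ j ∧ j ≤ (L : ℤ) - 1) (hM : 1 ≤ M)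
    (hm : ∀ k < M, ∑ j ∈ Finset.range L, a j * (j : ℝ) ^ k = 0)
    (hf : ContDiffOn ℝ (M : ℕ∞) f (Set.Ici 0)) {δ T : ℝ} (hδ : 0 < δ) {i : ℤ} (hi : 1 ≤ i)
    (hT : ((i : ℝ) + L - 1) * δ ≤ T) :
    |driftDiff a f δ i| ≤ (∑ j ∈ Finset.range L, |a j| * (j : ℝ) ^ M) * δ ^ M *
      sSup ((fun t => |iteratedDerivWithin M f (Set.Ici 0) t|) '' Set.Icc (0 : ℝ) T) := by
  set K := sSup ((fun t => |iteratedDerivWithin M f (Set.Ici 0) t|) '' Set.Icc (0 : ℝ) T) with hK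
  have hcont : ContinuousOn (fun t => |iteratedDerivWithin M f (Set.Ici 0) t|)
      (Set.Icc (0 : ℝ) T) :=
    ((hf.continuousOn_iteratedDerivWithin (by norm_cast) (uniqueDiffOn_Ici 0)).mono
      Set.Icc_subset_Ici_self).abs
  have hbdd := (isCompact_Icc.image_of_continuousOn hcont).bddAbove
  have hφ : ContDiffOn ℝ M f (Set.Ioi 0) := by
    exact_mod_cast hf.mono Set.Ioi_subset_Ici_self
  have hi0 : (1 : ℝ) ≤ i := by exact_mod_cast hi
  have hx₀ : 0 < (i : ℝ) * δ := by positivity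
  have hx : ∀ j : ℕ, 0 < ((i : ℝ) + j) * δ := fun j => by positivity
  have hder : ∀ j ∈ Finset.range L, ∀ ξ ∈ Set.uIcc ((i : ℝ) * δ) (((i : ℝ) + j) * δ),
      |iteratedDeriv M f ξ| ≤ K := by
    intro j hj ξ hξ
    have hle : (i : ℝ) * δ ≤ ((i : ℝ) + j) * δ := by nlinarith [(j.cast_nonneg : (0 : ℝ) ≤ j)]
    rw [Set.uIcc_of_le hle] at hξ
    have hξ0 : 0 < ξ := hx₀.trans_le hξ.1
    have hjL : (j : ℝ) ≤ L - 1 := by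
      have : j + 1 ≤ L := Finset.mem_range.1 hj
      have : (j : ℝ) + 1 ≤ L := by exact_mod_cast this
      linarith
    have hξT : ξ ≤ T := hξ.2.trans ((mul_le_mul_of_nonneg_right (by linarith) hδ.le).trans hT)
    have hat : ContDiffAt ℝ M f ξ := hφ.contDiffAt (Ioi_mem_nhds hξ0)
    rw [← iteratedDerivWithin_eq_iteratedDeriv (uniqueDiffOn_Ici 0) hat hξ0.le]
    exact le_csSup hbdd ⟨ξ, ⟨hξ0.le, hξT⟩, rfl⟩
  choose ξ hξ hξe using fun j : ℕ => exists_taylor_lagrange_Ioi hM hφ hx₀ (hx j)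
  have hdiff : driftDiff a f δ i = ∑ j ∈ Finset.range L,
      a j * (iteratedDeriv M f (ξ j) / (M.factorial : ℝ) * ((j : ℝ) * δ) ^ M) := by
    rw [driftDiff, finsum_mul_eq_sum_range hsupp]
    have h1 : ∀ j ∈ Finset.range L, a j * f (((i : ℤ) + (j : ℤ) : ℝ) * δ)
        = ∑ k ∈ Finset.range M,
            iteratedDeriv k f (i * δ) / (k.factorial : ℝ) * δ ^ k * (a j * (j : ℝ) ^ k)
          + a j * (iteratedDeriv M f (ξ j) / (M.factorial : ℝ) * ((j : ℝ) * δ) ^ M) := by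
      intro j _
      have e : ((i : ℝ) + j) * δ - i * δ = j * δ := by ring
      rw [Int.cast_natCast, hξe j, e, mul_add, Finset.mul_sum]
      congr 1
      exact Finset.sum_congr rfl fun k _ => by ring
    rw [Finset.sum_congr rfl h1, Finset.sum_add_distrib, Finset.sum_comm]
    simp_rw [← Finset.mul_sum]
    rw [Finset.sum_eq_zero, zero_add]
    intro k hk
    rw [hm k (Finset.mem_range.1 hk), mul_zero]
  have hK0 : 0 ≤ K := Real.sSup_nonneg (by rintro _ ⟨t, _, rfl⟩; exact abs_nonneg _)
  rw [hdiff, Finset.sum_mul, Finset.sum_mul]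
  refine (Finset.abs_sum_le_sum_abs _ _).trans (Finset.sum_le_sum fun j hj => ?_)
  rw [abs_mul, abs_mul, abs_div, Nat.abs_cast, abs_of_nonneg (by positivity : 0 ≤ (j * δ) ^ M),
    mul_pow]
  have hfac : (1 : ℝ) ≤ M.factorial := by exact_mod_cast M.factorial_pos
  have h2 : |iteratedDeriv M f (ξ j)| / (M.factorial : ℝ) ≤ K :=
    (div_le_self (abs_nonneg _) hfac).trans (hder j hj _ (hξ j))
  calc |a j| * (|iteratedDeriv M f (ξ j)| / (M.factorial : ℝ) * ((j : ℝ) ^ M * δ ^ M))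
      ≤ |a j| * (K * ((j : ℝ) ^ M * δ ^ M)) := by gcongr
    _ = |a j| * (j : ℝ) ^ M * δ ^ M * K := by ring

/-- The squared drift of the increments is negligible with respect to `√n δ_n^{2D+s}`. -/
lemma tendsto_sum_sq_driftDiff (hsupp : ∀ j : ℤ, a j ≠ 0 → 0 ≤ j ∧ j ≤ (L : ℤ) - 1) (hM : 1 ≤ M)
    (hm : ∀ k < M, ∑ j ∈ Finset.range L, a j * (j : ℝ) ^ k = 0) (hL : 1 ≤ L)
    (hf : ContDiffOn ℝ (M : ℕ∞) f (Set.Ici 0)) {D s α : ℝ}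
    (hK : (fun n : ℕ =>
        sSup ((fun t => |iteratedDerivWithin M f (Set.Ici 0) t|) ''
          Set.Icc (0:ℝ) ((n : ℝ) ^ (1 - α))))
      =o[atTop] fun n : ℕ =>
        (n : ℝ) ^ (-(1/4) : ℝ) * ((n : ℝ) ^ (-α)) ^ (D - (M : ℝ) + s / 2)) :
    Tendsto (fun n : ℕ => (∑ i : Fin (n - L + 1),
        (driftDiff a f ((n : ℝ) ^ (-α)) ((i : ℕ) + 1)) ^ 2)
          / (Real.sqrt n * ((n : ℝ) ^ (-α)) ^ (2 * D + s))) atTop (nhds 0) := by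
  set c := ∑ j ∈ Finset.range L, |a j| * (j : ℝ) ^ M with hc
  have h0 := (hK.tendsto_div_nhds_zero.pow 2).const_mul (c ^ 2)
  simp only [ne_eq, OfNat.ofNat_ne_zero, not_false_eq_true, zero_pow, mul_zero] at h0
  refine squeeze_zero' (Eventually.of_forall fun n => by positivity) ?_ h0
  filter_upwards [eventually_ge_atTop L] with n hn
  have hn1 : 0 < (n : ℝ) := by exact_mod_cast hL.trans hn
  set δ := (n : ℝ) ^ (-α) with hδ
  have hδ0 : 0 < δ := Real.rpow_pos_of_pos hn1 _
  set K := sSup ((fun t => |iteratedDerivWithin M f (Set.Ici 0) t|) ''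
          Set.Icc (0:ℝ) ((n : ℝ) ^ (1 - α))) with hKdef
  have hT : (n : ℝ) ^ (1 - α) = n * δ := by
    rw [sub_eq_add_neg, Real.rpow_add hn1, Real.rpow_one]
  have hle : ∑ i : Fin (n - L + 1), (driftDiff a f δ ((i : ℕ) + 1)) ^ 2
      ≤ n * (c * δ ^ M * K) ^ 2 := by
    have hcard : ((n - L + 1 : ℕ) : ℝ) ≤ n := by
      exact_mod_cast (by omega : n - L + 1 ≤ n)
    have hb : ∀ i : Fin (n - L + 1),
        (driftDiff a f δ ((i : ℕ) + 1)) ^ 2 ≤ (c * δ ^ M * K) ^ 2 := by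
      intro i
      refine sq_le_sq' ?_ ?_ <;> [refine neg_le_of_abs_le ?_; refine le_of_abs_le ?_] <;>
      · refine abs_driftDiff_le hsupp hM hm hf hδ0 (by omega) ?_
        rw [hT]
        refine mul_le_mul_of_nonneg_right ?_ hδ0.le
        have := i.2
        have h3 : (i : ℕ) + L ≤ n := by omega
        have h4 : ((i : ℕ) : ℝ) + L ≤ n := by exact_mod_cast h3
        push_cast
        linarith
    refine (Finset.sum_le_sum fun i _ => hb i).trans ?_
    rw [Finset.sum_const, Finset.card_univ, Fintype.card_fin, nsmul_eq_mul]
    exact mul_le_mul_of_nonneg_right hcard (sq_nonneg _)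
  have hw : 0 < Real.sqrt n * δ ^ (2 * D + s) := by positivity
  rw [div_le_iff₀ hw]
  refine hle.trans (le_of_eq ?_)
  have e1 : ((n : ℝ) ^ (-(1/4) : ℝ)) ^ 2 * n = Real.sqrt n := by
    rw [← Real.rpow_natCast, ← Real.rpow_mul hn1.le, Real.sqrt_eq_rpow]
    nth_rewrite 2 [← Real.rpow_one (n : ℝ)]
    rw [← Real.rpow_add hn1]
    norm_num
  have e2 : (δ ^ (D - (M : ℝ) + s / 2)) ^ 2 * (δ ^ M) ^ 2 = δ ^ (2 * D + s) := by
    rw [← mul_pow, ← Real.rpow_natCast δ M, ← Real.rpow_add hδ0, ← Real.rpow_natCast,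
      ← Real.rpow_mul hδ0.le]
    congr 1
    push_cast
    ring
  rw [← e1, ← e2]
  have hp1 : 0 < (n : ℝ) ^ (-(1/4) : ℝ) := by positivity
  have hp2 : 0 < δ ^ (D - (M : ℝ) + s / 2) := by positivity
  field_simp

end Drift

section CosineRemainder

/-- The `m`-th Taylor coefficient of the cosine at `0`. -/
noncomputable def cosCoeff (m : ℕ) : ℝ := (Complex.I ^ m / (m.factorial : ℂ)).re

/-- The remainder of the cosine after its Taylor polynomial of degree `2D`. -/
noncomputable def cosRem (D : ℕ) (u : ℝ) : ℝ :=
  Real.cos u - ∑ m ∈ Finset.range (2 * D + 1), cosCoeff m * u ^ m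

lemma cosCoeff_odd (k : ℕ) : cosCoeff (2 * k + 1) = 0 := by
  rw [cosCoeff, pow_succ, pow_mul, Complex.I_sq, ← Complex.ofReal_natCast, Complex.div_ofReal_re]
  have : ((-1 : ℂ) ^ k * Complex.I) = (((-1 : ℝ) ^ k : ℝ) : ℂ) * Complex.I := by push_cast; rfl
  rw [this, Complex.re_ofReal_mul]
  simp

lemma cosCoeff_mul_pow (m : ℕ) (u : ℝ) :
    cosCoeff m * u ^ m = ((((u : ℂ) * Complex.I) ^ m) / (m.factorial : ℂ)).re := by
  rw [mul_pow, mul_comm ((u : ℂ) ^ m), mul_div_right_comm, ← Complex.ofReal_pow,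
    Complex.re_mul_ofReal, cosCoeff]

lemma abs_cosCoeff_le_one (m : ℕ) : |cosCoeff m| ≤ 1 := by
  refine (Complex.abs_re_le_norm _).trans ?_
  rw [norm_div, norm_pow, Complex.norm_I, one_pow, Complex.norm_natCast]
  have : (1 : ℝ) ≤ m.factorial := by exact_mod_cast m.factorial_pos
  exact (div_le_one (by positivity)).2 this

lemma cosRem_neg (D : ℕ) (u : ℝ) : cosRem D (-u) = cosRem D u := by
  rw [cosRem, cosRem, Real.cos_neg]
  congr 1
  refine Finset.sum_congr rfl fun m _ => ?_
  rcases Nat.even_or_odd m with h | ⟨k, rfl⟩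
  · rw [h.neg_pow]
  · rw [cosCoeff_odd, zero_mul, zero_mul]

lemma cosRem_abs (D : ℕ) (u : ℝ) : cosRem D |u| = cosRem D u := by
  rcases abs_choice u with h | h <;> rw [h]
  exact cosRem_neg D u

lemma cosRem_zero (D : ℕ) : cosRem D 0 = 0 := by
  rw [cosRem, Finset.sum_range_succ']
  simp [cosCoeff]

lemma continuous_cosRem (D : ℕ) : Continuous (cosRem D) := by
  unfold cosRem
  fun_prop

lemma exists_abs_cosRem_le_near (D : ℕ) :
    ∃ c : ℝ, ∀ u : ℝ, 0 ≤ u → u ≤ 1 → |cosRem D u| ≤ c * u ^ (2 * D + 2) := by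
  refine ⟨((2 * D + 2).succ * ((2 * D + 2).factorial * (2 * D + 2 : ℕ) : ℝ)⁻¹), fun u h0 h1 => ?_⟩
  have hn : ‖(u : ℂ) * Complex.I‖ = u := by
    rw [norm_mul, Complex.norm_I, mul_one, Complex.norm_real, Real.norm_of_nonneg h0]
  have hb := Complex.exp_bound (x := (u : ℂ) * Complex.I) (by rw [hn]; exact h1)
    (n := 2 * D + 2) (by omega)
  rw [hn] at hb
  have e : cosRem D u = (Complex.exp ((u : ℂ) * Complex.I)
      - ∑ m ∈ Finset.range (2 * D + 2), ((u : ℂ) * Complex.I) ^ m / (m.factorial : ℂ)).re := by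
    rw [Complex.sub_re, Complex.exp_ofReal_mul_I_re, Complex.re_sum]
    simp_rw [← cosCoeff_mul_pow]
    rw [Finset.sum_range_succ, cosCoeff_odd, zero_mul, add_zero, cosRem]
  rw [e]
  refine (Complex.abs_re_le_norm _).trans (hb.trans (le_of_eq ?_))
  push_cast
  ring

lemma abs_cosRem_le_far (D : ℕ) {u : ℝ} (hu : 1 ≤ u) :
    |cosRem D u| ≤ (2 * D + 2) * u ^ (2 * D) := by
  have h1 : (1 : ℝ) ≤ u ^ (2 * D) := one_le_pow₀ hu
  have h2 : |∑ m ∈ Finset.range (2 * D + 1), cosCoeff m * u ^ m| ≤ (2 * D + 1) * u ^ (2 * D) := by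
    refine (Finset.abs_sum_le_sum_abs _ _).trans ?_
    refine (Finset.sum_le_card_nsmul _ _ (u ^ (2 * D)) fun m hm => ?_).trans (le_of_eq ?_)
    · rw [abs_mul, abs_of_nonneg (by positivity : 0 ≤ u ^ m)]
      have h3 : u ^ m ≤ u ^ (2 * D) :=
        pow_le_pow_right₀ hu (Nat.lt_succ_iff.1 (Finset.mem_range.1 hm))
      have := mul_le_mul (abs_cosCoeff_le_one m) h3 (by positivity) zero_le_one
      linarith
    · rw [Finset.card_range, nsmul_eq_mul]
      push_cast
      ring
  rw [cosRem]
  refine (abs_sub _ _).trans ?_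
  have := Real.abs_cos_le_one u
  linarith

lemma integrableOn_cosRem_mul_rpow (D : ℕ) {p : ℝ} (h1 : 2 * (D : ℝ) < p) (h2 : p < 2 * D + 2) :
    IntegrableOn (fun u : ℝ => cosRem D u * u ^ (-1 - p)) (Set.Ioi 0) := by
  have hmeas : AEStronglyMeasurable (fun u : ℝ => cosRem D u * u ^ (-1 - p))
      (volume.restrict (Set.Ioi 0)) :=
    ((continuous_cosRem D).measurable.mul (measurable_id.pow_const _)).aestronglyMeasurable
  rw [← Set.Ioc_union_Ioi_eq_Ioi (zero_le_one (α := ℝ))]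
  refine IntegrableOn.union ?_ ?_
  · obtain ⟨c, hc⟩ := exists_abs_cosRem_le_near D
    have hi : IntegrableOn (fun u : ℝ => c * u ^ (2 * (D : ℝ) + 1 - p)) (Set.Ioc 0 1) := by
      have := (intervalIntegral.intervalIntegrable_rpow' (a := 0) (b := 1)
        (by linarith : -1 < 2 * (D : ℝ) + 1 - p)).const_mul c
      rwa [intervalIntegrable_iff_integrableOn_Ioc_of_le zero_le_one] at this
    refine Integrable.mono' hi (hmeas.mono_set Set.Ioc_subset_Ioi_self) ?_
    filter_upwards [ae_restrict_mem measurableSet_Ioc] with u hu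
    have hu0 : 0 < u := hu.1
    rw [norm_mul, Real.norm_eq_abs, Real.norm_of_nonneg (by positivity : 0 ≤ u ^ (-1 - p))]
    have e : u ^ (2 * (D : ℝ) + 1 - p) = u ^ (2 * D + 2) * u ^ (-1 - p) := by
      rw [← Real.rpow_natCast, ← Real.rpow_add hu0]
      congr 1
      push_cast
      ring
    rw [e, ← mul_assoc]
    exact mul_le_mul_of_nonneg_right (hc u hu0.le hu.2) (by positivity)
  · have hi : IntegrableOn (fun u : ℝ => (2 * D + 2) * u ^ (2 * (D : ℝ) - 1 - p)) (Set.Ioi 1) :=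
      (integrableOn_Ioi_rpow_of_lt (by linarith) one_pos).const_mul _
    refine Integrable.mono' hi (hmeas.mono_set (Set.Ioi_subset_Ioi zero_le_one)) ?_
    filter_upwards [ae_restrict_mem measurableSet_Ioi] with u hu
    have hu1 : 1 < u := hu
    have hu0 : 0 < u := one_pos.trans hu1
    rw [norm_mul, Real.norm_eq_abs, Real.norm_of_nonneg (by positivity : 0 ≤ u ^ (-1 - p))]
    have e : u ^ (2 * (D : ℝ) - 1 - p) = u ^ (2 * D) * u ^ (-1 - p) := by
      rw [← Real.rpow_natCast, ← Real.rpow_add hu0]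
      congr 1
      push_cast
      ring
    rw [e, ← mul_assoc]
    exact mul_le_mul_of_nonneg_right (abs_cosRem_le_far D hu1.le) (by positivity)

lemma cosRem_scale (D : ℕ) (p x : ℝ) {t : ℝ} (ht : 0 < t) :
    cosRem D (x * t) * t ^ (-1 - p)
      = |x| ^ (1 + p) * (cosRem D (|x| * t) * (|x| * t) ^ (-1 - p)) := by
  by_cases hx : x = 0
  · simp [hx, cosRem_zero]
  have hx0 : 0 < |x| := abs_pos.2 hx
  have e : |x| ^ (1 + p) * |x| ^ (-1 - p) = 1 := by
    rw [← Real.rpow_add hx0]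
    simp
  have e2 : cosRem D (|x| * t) = cosRem D (x * t) := by
    rw [← cosRem_abs D (x * t), abs_mul, abs_of_pos ht]
  rw [Real.mul_rpow hx0.le ht.le, e2]
  linear_combination -(cosRem D (x * t) * t ^ (-1 - p)) * e

lemma integrableOn_cosRem_scale (D : ℕ) {p : ℝ} (h1 : 2 * (D : ℝ) < p) (h2 : p < 2 * D + 2)
    (x : ℝ) : IntegrableOn (fun t : ℝ => cosRem D (x * t) * t ^ (-1 - p)) (Set.Ioi 0) := by
  by_cases hx : x = 0
  · simp [hx, cosRem_zero]
  have hx0 : 0 < |x| := abs_pos.2 hx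
  have h := (integrableOn_Ioi_comp_mul_left_iff
    (fun u : ℝ => cosRem D u * u ^ (-1 - p)) 0 hx0).2
      (by simpa using integrableOn_cosRem_mul_rpow D h1 h2)
  exact IntegrableOn.congr_fun (h.const_mul (|x| ^ (1 + p)))
    (fun t ht => (cosRem_scale D p x ht).symm) measurableSet_Ioi

lemma integral_cosRem_scale (D : ℕ) {p : ℝ} (hp : 0 < p) (x : ℝ) :
    ∫ t in Set.Ioi 0, cosRem D (x * t) * t ^ (-1 - p)
      = |x| ^ p * ∫ t in Set.Ioi 0, cosRem D t * t ^ (-1 - p) := by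
  by_cases hx : x = 0
  · simp [hx, cosRem_zero, Real.zero_rpow hp.ne']
  have hx0 : 0 < |x| := abs_pos.2 hx
  rw [setIntegral_congr_fun measurableSet_Ioi fun t ht => cosRem_scale D p x ht,
    integral_const_mul,
    integral_comp_mul_left_Ioi (fun u : ℝ => cosRem D u * u ^ (-1 - p)) 0 hx0, mul_zero,
    smul_eq_mul, ← mul_assoc, Real.rpow_add hx0, Real.rpow_one]
  field_simp

end CosineRemainder

section Nonvanishing

variable {a : ℤ → ℝ} {L M : ℕ}

lemma sum_mul_cosRem (hm : ∀ k < M, ∑ j ∈ Finset.range L, a j * (j : ℝ) ^ k = 0) {D : ℕ}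
    (hD : D < M) (t : ℝ) :
    ∑ j ∈ Finset.range L, ∑ l ∈ Finset.range L, a j * a l * cosRem D (((j : ℝ) - l) * t)
      = (∑ j ∈ Finset.range L, a j * Real.cos (j * t)) ^ 2
        + (∑ j ∈ Finset.range L, a j * Real.sin (j * t)) ^ 2 := by
  have h : ∀ j l : ℕ, a j * a l * cosRem D (((j : ℝ) - l) * t)
      = (a j * Real.cos (j * t) * (a l * Real.cos (l * t))
        + a j * Real.sin (j * t) * (a l * Real.sin (l * t)))
        - ∑ m ∈ Finset.range (2 * D + 1),
            cosCoeff m * t ^ m * (a j * a l * ((j : ℝ) - l) ^ m) := by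
    intro j l
    rw [cosRem, sub_mul, Real.cos_sub, mul_sub, Finset.mul_sum]
    congr 1
    · ring
    · refine Finset.sum_congr rfl fun m _ => ?_
      rw [← sub_mul, mul_pow]
      ring
  simp_rw [h, Finset.sum_sub_distrib, Finset.sum_add_distrib]
  rw [pow_two, pow_two, Finset.sum_mul_sum, Finset.sum_mul_sum, sub_eq_self]
  have h3 : ∀ j ∈ Finset.range L, ∑ l ∈ Finset.range L, ∑ m ∈ Finset.range (2 * D + 1),
      cosCoeff m * t ^ m * (a j * a l * ((j : ℝ) - l) ^ m)
      = ∑ m ∈ Finset.range (2 * D + 1), cosCoeff m * t ^ m *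
        ∑ l ∈ Finset.range L, (a j * a l * ((j : ℝ) - l) ^ m) := fun j _ => by
    rw [Finset.sum_comm]
    exact Finset.sum_congr rfl fun m _ => by rw [Finset.mul_sum]
  rw [Finset.sum_congr rfl h3, Finset.sum_comm]
  refine Finset.sum_eq_zero fun m hmr => ?_
  rw [← Finset.mul_sum, sum_moment_sub_eq_zero hm (by have := Finset.mem_range.1 hmr; omega),
    mul_zero]

lemma exists_trigSum_ne_zero (hL : 1 ≤ L) (ha0 : a 0 ≠ 0) :
    ∃ t : ℝ, 0 < t ∧ (∑ j ∈ Finset.range L, a j * Real.cos (j * t)) ^ 2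
        + (∑ j ∈ Finset.range L, a j * Real.sin (j * t)) ^ 2 ≠ 0 := by
  by_contra! hcon
  set P : Polynomial ℂ := ∑ j ∈ Finset.range L, Polynomial.monomial j ((a j : ℝ) : ℂ) with hP
  have hroot : ∀ t : ℝ, 0 < t → P.IsRoot (Complex.exp (t * Complex.I)) := by
    intro t ht
    have h := hcon t ht
    obtain ⟨hc, hs⟩ := (add_eq_zero_iff_of_nonneg (sq_nonneg _) (sq_nonneg _)).1 h
    rw [sq_eq_zero_iff] at hc hs
    rw [Polynomial.IsRoot, hP, Polynomial.eval_finsetSum]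
    have e : ∀ j : ℕ, Polynomial.eval (Complex.exp (t * Complex.I))
        (Polynomial.monomial j ((a j : ℝ) : ℂ))
        = ((a j * Real.cos (j * t) : ℝ) : ℂ) + ((a j * Real.sin (j * t) : ℝ) : ℂ) * Complex.I := by
      intro j
      rw [Polynomial.eval_monomial, ← Complex.exp_nat_mul, ← mul_assoc,
        ← Complex.ofReal_natCast, ← Complex.ofReal_mul, Complex.exp_mul_I]
      push_cast
      ring
    simp_rw [e, Finset.sum_add_distrib, ← Finset.sum_mul, ← Complex.ofReal_sum]
    rw [hc, hs]
    simp
  have hinf : Set.Infinite {z | P.IsRoot z} := by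
    refine ((Set.Ioo_infinite Real.pi_pos).image
      (f := fun t : ℝ => Complex.exp (t * Complex.I)) ?_).mono ?_
    · intro x hx y hy hxy
      refine Real.injOn_cos ⟨hx.1.le, hx.2.le⟩ ⟨hy.1.le, hy.2.le⟩ ?_
      have := congrArg Complex.re hxy
      simpa only [Complex.exp_ofReal_mul_I_re] using this
    · rintro _ ⟨t, ht, rfl⟩
      exact hroot t ht.1
  have hP0 := Polynomial.eq_zero_of_infinite_isRoot P hinf
  have hcoef : P.coeff 0 = ((a 0 : ℝ) : ℂ) := by
    rw [hP, Polynomial.finsetSum_coeff]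
    simp only [Polynomial.coeff_monomial]
    rw [Finset.sum_ite_eq' (Finset.range L) 0 fun j : ℕ => ((a j : ℝ) : ℂ),
      if_pos (Finset.mem_range.2 hL)]
    simp
  rw [hP0, Polynomial.coeff_zero] at hcoef
  exact ha0 (by exact_mod_cast hcoef.symm)

/-- The generalized covariance `|·|^p` is nondegenerate on sequences with enough vanishing
moments. -/
lemma sum_abs_sub_rpow_ne_zero (hm : ∀ k < M, ∑ j ∈ Finset.range L, a j * (j : ℝ) ^ k = 0)
    (hL : 1 ≤ L) (ha0 : a 0 ≠ 0) {D : ℕ} (hD : D < M) {p : ℝ} (h1 : 2 * (D : ℝ) < p)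
    (h2 : p < 2 * D + 2) :
    ∑ j ∈ Finset.range L, ∑ l ∈ Finset.range L, a j * a l * |(j : ℝ) - l| ^ p ≠ 0 := by
  have hp : 0 < p := lt_of_le_of_lt (by positivity) h1
  set Q : ℝ → ℝ := fun t => (∑ j ∈ Finset.range L, a j * Real.cos (j * t)) ^ 2
        + (∑ j ∈ Finset.range L, a j * Real.sin (j * t)) ^ 2 with hQ
  have hQc : Continuous Q := by rw [hQ]; fun_prop
  have hQe : ∀ t : ℝ, Q t * t ^ (-1 - p) = ∑ j ∈ Finset.range L, ∑ l ∈ Finset.range L,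
      a j * a l * (cosRem D (((j : ℝ) - l) * t) * t ^ (-1 - p)) := by
    intro t
    rw [hQ]
    simp only
    rw [← sum_mul_cosRem hm hD, Finset.sum_mul]
    refine Finset.sum_congr rfl fun j _ => ?_
    rw [Finset.sum_mul]
    exact Finset.sum_congr rfl fun l _ => by ring
  have hint : ∀ j l : ℕ, Integrable (fun t : ℝ =>
      a j * a l * (cosRem D (((j : ℝ) - l) * t) * t ^ (-1 - p)))
      (volume.restrict (Set.Ioi 0)) := fun j l =>
    Integrable.const_mul (integrableOn_cosRem_scale D h1 h2 _) _
  have hI : ∫ t in Set.Ioi 0, Q t * t ^ (-1 - p)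
      = (∑ j ∈ Finset.range L, ∑ l ∈ Finset.range L, a j * a l * |(j : ℝ) - l| ^ p)
        * ∫ t in Set.Ioi 0, cosRem D t * t ^ (-1 - p) := by
    simp_rw [hQe]
    rw [integral_finsetSum _ fun j _ => integrable_finsetSum _ fun l _ => hint j l,
      Finset.sum_mul]
    refine Finset.sum_congr rfl fun j _ => ?_
    rw [integral_finsetSum _ fun l _ => hint j l, Finset.sum_mul]
    refine Finset.sum_congr rfl fun l _ => ?_
    rw [integral_const_mul, integral_cosRem_scale D hp]
    ring
  have hQi : IntegrableOn (fun t => Q t * t ^ (-1 - p)) (Set.Ioi 0) := by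
    simp_rw [hQe]
    exact integrable_finsetSum _ fun j _ => integrable_finsetSum _ fun l _ => hint j l
  have hpos : 0 < ∫ t in Set.Ioi 0, Q t * t ^ (-1 - p) := by
    rw [setIntegral_pos_iff_support_of_nonneg_ae _ hQi]
    · obtain ⟨t₀, ht₀, hne⟩ := exists_trigSum_ne_zero hL ha0
      have hopen : IsOpen ({t | Q t ≠ 0} ∩ Set.Ioi 0) :=
        (isOpen_ne_fun hQc continuous_const).inter isOpen_Ioi
      refine (hopen.measure_pos volume ⟨t₀, hne, ht₀⟩).trans_le (measure_mono ?_)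
      rintro t ⟨hQt, ht⟩
      exact ⟨mul_ne_zero hQt (Real.rpow_pos_of_pos ht _).ne', ht⟩
    · filter_upwards [ae_restrict_mem measurableSet_Ioi] with t ht
      have ht0 : (0 : ℝ) < t := ht
      have : 0 ≤ Q t := by rw [hQ]; positivity
      exact mul_nonneg this (Real.rpow_pos_of_pos ht0 _).le
  intro h0
  rw [hI, h0, zero_mul] at hpos
  exact lt_irrefl _ hpos

end Nonvanishing

section FarCovariance

variable {a : ℤ → ℝ} {L M : ℕ}

lemma abs_sum_cov_le_of_far (hm : ∀ k < M, ∑ j ∈ Finset.range L, a j * (j : ℝ) ^ k = 0)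
    {V : ℝ → ℝ} {q : ℕ} (hq1 : 1 ≤ q) (hq2 : q ≤ 2 * M) (hV : ContDiffOn ℝ q V (Set.Ioi 0))
    {δ k B : ℝ} (hδ : 0 < δ) (hk0 : 0 < k) (hk : 2 * (L : ℝ) ≤ k)
    (hB : ∀ ξ, k * δ / 2 ≤ ξ → |iteratedDeriv q V ξ| ≤ B) :
    |∑ j ∈ Finset.range L, ∑ l ∈ Finset.range L, a j * a l * V ((k + ((j : ℝ) - l)) * δ)|
      ≤ (∑ j ∈ Finset.range L, ∑ l ∈ Finset.range L, |a j * a l| * |(j : ℝ) - l| ^ q)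
        * (δ ^ q * B) := by
  have hx₀ : 0 < k * δ := by positivity
  have hlow : ∀ j ∈ Finset.range L, ∀ l ∈ Finset.range L,
      k * δ / 2 ≤ (k + ((j : ℝ) - l)) * δ := by
    intro j _ l hl
    have h1 : (l : ℝ) ≤ L := by exact_mod_cast (Finset.mem_range.1 hl).le
    have h2 : (0 : ℝ) ≤ j := j.cast_nonneg
    have h3 : k / 2 ≤ k + ((j : ℝ) - l) := by linarith
    calc k * δ / 2 = k / 2 * δ := by ring
      _ ≤ _ := mul_le_mul_of_nonneg_right h3 hδ.le
  have hterm : ∀ j ∈ Finset.range L, ∀ l ∈ Finset.range L, ∃ θ : ℝ, |θ| ≤ B ∧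
      V ((k + ((j : ℝ) - l)) * δ) = ∑ m ∈ Finset.range q,
        iteratedDeriv m V (k * δ) / (m.factorial : ℝ) * δ ^ m * ((j : ℝ) - l) ^ m
        + θ / (q.factorial : ℝ) * δ ^ q * ((j : ℝ) - l) ^ q := by
    intro j hj l hl
    have hlo := hlow j hj l hl
    obtain ⟨ξ, hξ, he⟩ := exists_taylor_lagrange_Ioi hq1 hV hx₀
      (lt_of_lt_of_le (by positivity) hlo)
    refine ⟨iteratedDeriv q V ξ, hB ξ ((le_min (by linarith) hlo).trans hξ.1), ?_⟩
    have e : (k + ((j : ℝ) - l)) * δ - k * δ = δ * ((j : ℝ) - l) := by ring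
    rw [he, e]
    simp_rw [mul_pow, mul_assoc]
  have hB0 : 0 ≤ B := (abs_nonneg _).trans (hB (k * δ) (by linarith))
  have hfac : (1 : ℝ) ≤ q.factorial := by exact_mod_cast q.factorial_pos
  set P : ℕ → ℕ → ℝ := fun j l => ∑ m ∈ Finset.range q,
        iteratedDeriv m V (k * δ) / (m.factorial : ℝ) * δ ^ m * ((j : ℝ) - l) ^ m with hP
  have hP0 : ∑ j ∈ Finset.range L, ∑ l ∈ Finset.range L, a j * a l * P j l = 0 := by
    have h3 : ∀ j ∈ Finset.range L, ∑ l ∈ Finset.range L, a j * a l * P j l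
        = ∑ m ∈ Finset.range q, iteratedDeriv m V (k * δ) / (m.factorial : ℝ) * δ ^ m *
          ∑ l ∈ Finset.range L, (a j * a l * ((j : ℝ) - l) ^ m) := fun j _ => by
      simp_rw [hP, Finset.mul_sum]
      rw [Finset.sum_comm]
      exact Finset.sum_congr rfl fun m _ => Finset.sum_congr rfl fun l _ => by ring
    rw [Finset.sum_congr rfl h3, Finset.sum_comm]
    refine Finset.sum_eq_zero fun m hmr => ?_
    rw [← Finset.mul_sum, sum_moment_sub_eq_zero hm (by have := Finset.mem_range.1 hmr; omega),
      mul_zero]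
  have hsplit : ∑ j ∈ Finset.range L, ∑ l ∈ Finset.range L,
      a j * a l * V ((k + ((j : ℝ) - l)) * δ)
      = ∑ j ∈ Finset.range L, ∑ l ∈ Finset.range L,
        a j * a l * (V ((k + ((j : ℝ) - l)) * δ) - P j l) := by
    simp_rw [mul_sub, Finset.sum_sub_distrib]
    rw [hP0, sub_zero]
  rw [hsplit, Finset.sum_mul]
  refine (Finset.abs_sum_le_sum_abs _ _).trans (Finset.sum_le_sum fun j hj => ?_)
  rw [Finset.sum_mul]
  refine (Finset.abs_sum_le_sum_abs _ _).trans (Finset.sum_le_sum fun l hl => ?_)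
  obtain ⟨θ, hθ, he⟩ := hterm j hj l hl
  rw [he, hP]
  simp only
  rw [add_sub_cancel_left, abs_mul (a j * a l), abs_mul _ (((j : ℝ) - l) ^ q),
    abs_mul _ (δ ^ q), abs_div, Nat.abs_cast, abs_pow, abs_pow, abs_of_pos hδ]
  have h2 : |θ| / (q.factorial : ℝ) ≤ B := (div_le_self (abs_nonneg _) hfac).trans hθ
  calc |a j * a l| * (|θ| / (q.factorial : ℝ) * δ ^ q * |(j : ℝ) - l| ^ q)
      ≤ |a j * a l| * (B * δ ^ q * |(j : ℝ) - l| ^ q) := by gcongr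
    _ = _ := by ring

/-- High-order derivatives of a function whose `q`-th derivative is a power up to a remainder. -/
lemma exists_abs_iteratedDeriv_le {V r : ℝ → ℝ} {q d : ℕ} (hd : 0 < d) {c₀ c₁ s β K : ℝ}
    (hExp : ∀ h : ℝ, iteratedDeriv q V h = c₀ + c₁ * |h| ^ s + r h)
    (hrd : ContDiffOn ℝ (d : ℕ∞) r {(0:ℝ)}ᶜ)
    (hr : ∀ h : ℝ, h ≠ 0 → |iteratedDeriv d r h| ≤ K * |h| ^ β) :
    ∃ K' : ℝ, 0 ≤ K' ∧ ∀ h : ℝ, 0 < h →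
      |iteratedDeriv (q + d) V h| ≤ K' * (h ^ (s - d) + h ^ β) := by
  refine ⟨max |c₁ * (descPochhammer ℝ d).eval s| K, le_max_of_le_left (abs_nonneg _),
    fun h hh => ?_⟩
  have e1 : iteratedDeriv (q + d) V h = iteratedDeriv d (iteratedDeriv q V) h := by
    rw [iteratedDeriv_eq_iterate, iteratedDeriv_eq_iterate, iteratedDeriv_eq_iterate,
      add_comm, Function.iterate_add_apply]
  have e2 : iteratedDeriv q V =ᶠ[nhds h] fun y => c₀ + (c₁ * y ^ s + r y) := by
    filter_upwards [Ioi_mem_nhds hh] with y hy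
    rw [hExp y, abs_of_pos hy, add_assoc]
  have h1 : ContDiffAt ℝ d (fun y : ℝ => y ^ s) h := Real.contDiffAt_rpow_const_of_ne hh.ne'
  have h2 : ContDiffAt ℝ d r h := by
    exact_mod_cast hrd.contDiffAt (isOpen_compl_singleton.mem_nhds hh.ne')
  rw [e1, e2.iteratedDeriv_eq, iteratedDeriv_const_add hd,
    iteratedDeriv_fun_add (contDiffAt_const.mul h1) h2, iteratedDeriv_const_mul _ h1,
    iteratedDeriv_eq_iterate (f := fun y : ℝ => y ^ s), Real.iter_deriv_rpow_const, mul_add]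
  have hr' := hr h hh.ne'
  rw [abs_of_pos hh] at hr'
  refine (abs_add_le _ _).trans (add_le_add ?_ (hr'.trans ?_))
  · rw [← mul_assoc, abs_mul, abs_of_pos (Real.rpow_pos_of_pos hh _)]
    exact mul_le_mul_of_nonneg_right (le_max_left _ _) (by positivity)
  · exact mul_le_mul_of_nonneg_right (le_max_right _ _) (by positivity)

/-- Decay of the covariance of the increments away from the diagonal. -/
lemma exists_abs_sum_cov_le (hm : ∀ k < M, ∑ j ∈ Finset.range L, a j * (j : ℝ) ^ k = 0)
    (hL : 1 ≤ L) {V r : ℝ → ℝ} {q d : ℕ} (hd : 0 < d) (hqd : q + d ≤ 2 * M)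
    (hV : ContDiffOn ℝ (⊤ : ℕ∞) V (Set.Ioi 0)) {c₀ c₁ s β K : ℝ}
    (hExp : ∀ h : ℝ, iteratedDeriv q V h = c₀ + c₁ * |h| ^ s + r h)
    (hrd : ContDiffOn ℝ (d : ℕ∞) r {(0:ℝ)}ᶜ)
    (hr : ∀ h : ℝ, h ≠ 0 → |iteratedDeriv d r h| ≤ K * |h| ^ β) (hβ : s - d < β) (hβ0 : β < 0) :
    ∃ c : ℝ, 0 ≤ c ∧ ∀ δ k : ℝ, 0 < δ → δ ≤ 1 → 2 * (L : ℝ) ≤ k →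
      |∑ j ∈ Finset.range L, ∑ l ∈ Finset.range L, a j * a l * V ((k + ((j : ℝ) - l)) * δ)|
        ≤ c * δ ^ ((q : ℝ) + s) * (k + 1) ^ β := by
  obtain ⟨K', hK', hder⟩ := exists_abs_iteratedDeriv_le hd hExp hrd hr
  have hV' : ContDiffOn ℝ (q + d : ℕ) V (Set.Ioi 0) := hV.of_le (by exact_mod_cast le_top)
  set c₂ := ∑ j ∈ Finset.range L, ∑ l ∈ Finset.range L, |a j * a l| * |(j : ℝ) - l| ^ (q + d)
    with hc₂
  have hc₂0 : 0 ≤ c₂ := by positivity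
  refine ⟨c₂ * (K' * (2 * (1 / 4 : ℝ) ^ β)), by positivity, fun δ k hδ hδ1 hk => ?_⟩
  have hL' : (1 : ℝ) ≤ L := by exact_mod_cast hL
  have hk0 : 0 < k := by linarith
  have hkδ : 0 < k * δ / 2 := by positivity
  have hsd : s - d < 0 := hβ.trans hβ0
  refine (abs_sum_cov_le_of_far hm (by omega) hqd hV' hδ hk0 hk
    (B := K' * (2 * (1 / 4 : ℝ) ^ β) * (δ ^ (s - d) * (k + 1) ^ β)) fun ξ hξ => ?_).trans
      (le_of_eq ?_)
  · have hξ0 : 0 < ξ := hkδ.trans_le hξ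
    refine (hder ξ hξ0).trans ?_
    have hk4 : 1 ≤ k / 2 := by linarith
    have hbase : (k / 2) ^ β ≤ (1 / 4 : ℝ) ^ β * (k + 1) ^ β := by
      rw [← Real.mul_rpow (by norm_num) (by linarith)]
      exact Real.rpow_le_rpow_of_nonpos (by linarith) (by linarith) hβ0.le
    have h1 : ξ ^ (s - d) ≤ δ ^ (s - d) * ((1 / 4 : ℝ) ^ β * (k + 1) ^ β) := by
      calc ξ ^ (s - d) ≤ (k * δ / 2) ^ (s - d) := Real.rpow_le_rpow_of_nonpos hkδ hξ hsd.le
        _ = δ ^ (s - d) * (k / 2) ^ (s - d) := by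
          rw [← Real.mul_rpow hδ.le (by linarith)]
          congr 1
          ring
        _ ≤ δ ^ (s - d) * (k / 2) ^ β := by
          gcongr
        _ ≤ _ := by gcongr
    have h2 : ξ ^ β ≤ δ ^ (s - d) * ((1 / 4 : ℝ) ^ β * (k + 1) ^ β) := by
      calc ξ ^ β ≤ (k * δ / 2) ^ β := Real.rpow_le_rpow_of_nonpos hkδ hξ hβ0.le
        _ = δ ^ β * (k / 2) ^ β := by
          rw [← Real.mul_rpow hδ.le (by linarith)]
          congr 1
          ring
        _ ≤ δ ^ (s - d) * (k / 2) ^ β := by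
          refine mul_le_mul_of_nonneg_right ?_ (by positivity)
          exact Real.rpow_le_rpow_of_exponent_ge hδ hδ1 hβ.le
        _ ≤ _ := by gcongr
    calc K' * (ξ ^ (s - d) + ξ ^ β)
        ≤ K' * (δ ^ (s - d) * ((1 / 4 : ℝ) ^ β * (k + 1) ^ β)
          + δ ^ (s - d) * ((1 / 4 : ℝ) ^ β * (k + 1) ^ β)) := by gcongr
      _ = _ := by ring
  · have e : δ ^ ((q : ℝ) + s) = δ ^ (q + d) * δ ^ (s - d) := by
      rw [← Real.rpow_natCast, ← Real.rpow_add hδ]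
      congr 1
      push_cast
      ring
    rw [e]
    ring

end FarCovariance

section NearDiagonal

/-- The constant by which `|x|^{2D+s}` arises from `|x|^s` by `2D` integrations. -/
noncomputable def taylorConst (D : ℕ) (s : ℝ) : ℝ :=
  if D = 0 then 1
  else ∫ η in (0:ℝ)..1, (1 - η) ^ (2 * D - 1) / (Nat.factorial (2 * D - 1) : ℝ) * |η| ^ s

lemma continuous_abs_rpow {s : ℝ} (hs : 0 < s) : Continuous fun x : ℝ => |x| ^ s :=
  continuous_abs.rpow_const fun _ => Or.inr hs.le

lemma taylorConst_pos (D : ℕ) {s : ℝ} (hs : 0 < s) : 0 < taylorConst D s := by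
  rw [taylorConst]
  split_ifs with h
  · exact one_pos
  · have hc := continuous_abs_rpow hs
    refine intervalIntegral.intervalIntegral_pos_of_pos_on
      (Continuous.intervalIntegrable (by fun_prop) _ _) (fun x hx => ?_) one_pos
    have h1 : 0 < 1 - x := by linarith [hx.2]
    have h2 : 0 < |x| := abs_pos.2 hx.1.ne'
    positivity

lemma pow_two_mul_mul_abs_rpow (D : ℕ) {s : ℝ} (hs : 0 < s) (x : ℝ) :
    x ^ (2 * D) * |x| ^ s = |x| ^ (2 * (D : ℝ) + s) := by
  by_cases hx : x = 0
  · rw [hx, abs_zero, Real.zero_rpow hs.ne', Real.zero_rpow (by positivity), mul_zero]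
  · rw [Real.rpow_add (abs_pos.2 hx), pow_mul, ← sq_abs, ← pow_mul, ← Real.rpow_natCast]
    push_cast
    rfl

lemma Rq_seqConv_eq {a : ℤ → ℝ} {L : ℕ} (hsupp : ∀ j : ℤ, a j ≠ 0 → 0 ≤ j ∧ j ≤ (L : ℤ) - 1)
    (D : ℕ) {s : ℝ} (hs : 0 < s) :
    Rq 0 1 (2 * D) (fun x => |x| ^ s) (seqConv a a)
      = -(taylorConst D s * ∑ j ∈ Finset.range L, ∑ l ∈ Finset.range L,
          a j * a l * |(j : ℝ) - l| ^ (2 * (D : ℝ) + s)) := by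
  rw [Rq, taylorConst]
  by_cases hD : D = 0
  · rw [if_pos (by omega), if_pos hD, finsum_seqConv_mul hsupp, hD]
    simp
  · rw [if_neg (by omega), if_neg hD]
    simp_rw [mul_assoc (seqConv a a _)]
    rw [finsum_seqConv_mul hsupp, Finset.mul_sum]
    congr 1
    refine Finset.sum_congr rfl fun j _ => ?_
    rw [Finset.mul_sum]
    refine Finset.sum_congr rfl fun l _ => ?_
    rw [← pow_two_mul_mul_abs_rpow D hs]
    have e : ∀ η : ℝ, (1 - η) ^ (2 * D - 1) / (Nat.factorial (2 * D - 1) : ℝ)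
        * |(((0 : ℤ) : ℝ) + (((j : ℤ) - (l : ℤ) : ℤ) : ℝ) * η) * 1| ^ s
        = |(j : ℝ) - l| ^ s * ((1 - η) ^ (2 * D - 1) / (Nat.factorial (2 * D - 1) : ℝ)
          * |η| ^ s) := by
      intro η
      push_cast
      rw [zero_add, mul_one, abs_mul, Real.mul_rpow (abs_nonneg _) (abs_nonneg _)]
      ring
    simp_rw [e]
    rw [intervalIntegral.integral_const_mul]
    push_cast
    ring

lemma integral_pow_mul_abs_rpow {D : ℕ} (hD : D ≠ 0) {s : ℝ} (hs : 0 < s) (x : ℝ) :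
    ∫ t in (0:ℝ)..x, (x - t) ^ (2 * D - 1) / (Nat.factorial (2 * D - 1) : ℝ) * |t| ^ s
      = taylorConst D s * |x| ^ (2 * (D : ℝ) + s) := by
  have h := intervalIntegral.mul_integral_comp_mul_left (a := 0) (b := 1) (c := x)
    (f := fun t => (x - t) ^ (2 * D - 1) / (Nat.factorial (2 * D - 1) : ℝ) * |t| ^ s)
  rw [mul_zero, mul_one] at h
  rw [← h, taylorConst, if_neg hD, ← pow_two_mul_mul_abs_rpow D hs]
  have e : ∀ η : ℝ, (x - x * η) ^ (2 * D - 1) / (Nat.factorial (2 * D - 1) : ℝ) * |x * η| ^ s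
      = x ^ (2 * D - 1) * |x| ^ s
        * ((1 - η) ^ (2 * D - 1) / (Nat.factorial (2 * D - 1) : ℝ) * |η| ^ s) := by
    intro η
    rw [abs_mul, Real.mul_rpow (abs_nonneg _) (abs_nonneg _),
      show x - x * η = x * (1 - η) by ring, mul_pow]
    ring
  simp_rw [e]
  rw [intervalIntegral.integral_const_mul]
  obtain ⟨n, hn⟩ : ∃ n, 2 * D = n + 1 := ⟨2 * D - 1, by omega⟩
  rw [hn, Nat.add_sub_cancel, pow_succ]
  ring

/-- Expansion at the origin of a function whose `2D`-th derivative is a power up to a remainder. -/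
lemma isLittleO_taylor_rpow {V r : ℝ → ℝ} {D : ℕ} {c₁ s γ : ℝ} (hs : 0 < s) (hγ : 0 ≤ γ)
    (hV : ContDiff ℝ ((2 * D : ℕ) : ℕ∞) V)
    (hExp : ∀ h : ℝ, iteratedDeriv (2 * D) V h = iteratedDeriv (2 * D) V 0 + c₁ * |h| ^ s + r h)
    (hr : r =o[nhds (0:ℝ)] fun h => |h| ^ (s + γ)) :
    (fun x => V x - ∑ k ∈ Finset.range (2 * D + 1),
        iteratedDeriv k V 0 / (k.factorial : ℝ) * x ^ k
        - c₁ * (taylorConst D s * |x| ^ (2 * (D : ℝ) + s)))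
      =o[nhds (0:ℝ)] fun x => |x| ^ (2 * (D : ℝ) + s + γ) := by
  by_cases hD : D = 0
  · subst hD
    simp only [mul_zero, iteratedDeriv_zero] at hExp
    refine (hr.congr_left fun x => ?_).congr_right fun x => ?_
    · rw [hExp x]
      simp [taylorConst]
      ring
    · simp
  obtain ⟨n, hn⟩ : ∃ n, 2 * D = n + 1 := ⟨2 * D - 1, by omega⟩
  have hrc : Continuous r := by
    have e : r = fun h => iteratedDeriv (2 * D) V h - iteratedDeriv (2 * D) V 0 - c₁ * |h| ^ s := by
      funext h
      rw [hExp h]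
      ring
    have h1 : Continuous (iteratedDeriv (2 * D) V) :=
      hV.continuous_iteratedDeriv _ (by norm_cast)
    have h2 := continuous_abs_rpow hs
    rw [e]
    fun_prop
  have hrem : ∀ x : ℝ, V x - ∑ k ∈ Finset.range (2 * D + 1),
        iteratedDeriv k V 0 / (k.factorial : ℝ) * x ^ k
        - c₁ * (taylorConst D s * |x| ^ (2 * (D : ℝ) + s))
      = ∫ t in (0:ℝ)..x, (x - t) ^ n / (n.factorial : ℝ) * r t := by
    intro x
    by_cases hx : x = 0
    · subst hx
      rw [Finset.sum_range_succ']
      simp [Real.zero_rpow (by positivity : 2 * (D : ℝ) + s ≠ 0)]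
    have hu : UniqueDiffOn ℝ (Set.uIcc 0 x) := uniqueDiffOn_uIcc (Ne.symm hx)
    have hVn : ContDiff ℝ (n + 1 : ℕ) V := by
      rw [← hn]
      exact_mod_cast hV
    have ht := taylor_integral_remainder (x₀ := 0) (x := x) hVn.contDiffOn
    have h1 : taylorWithinEval V n (Set.uIcc 0 x) 0 x = ∑ k ∈ Finset.range (2 * D),
        iteratedDeriv k V 0 / (k.factorial : ℝ) * x ^ k := by
      rw [taylor_within_apply, hn]
      refine Finset.sum_congr rfl fun k hk => ?_
      have hk' : k ≤ n + 1 := (Finset.mem_range.1 hk).le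
      rw [iteratedDerivWithin_eq_iteratedDeriv hu
        (hVn.contDiffAt.of_le (by exact_mod_cast hk')) Set.left_mem_uIcc, smul_eq_mul, sub_zero]
      field_simp
    have h2 : ∫ t in (0:ℝ)..x, ((x - t) ^ n / (n.factorial : ℝ)) •
          iteratedDerivWithin (n + 1) V (Set.uIcc 0 x) t
        = ∫ t in (0:ℝ)..x, ((x - t) ^ n / (n.factorial : ℝ) * iteratedDeriv (2 * D) V 0
          + c₁ * ((x - t) ^ n / (n.factorial : ℝ) * |t| ^ s)
          + (x - t) ^ n / (n.factorial : ℝ) * r t) := by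
      refine intervalIntegral.integral_congr fun t ht => ?_
      rw [iteratedDerivWithin_eq_iteratedDeriv hu hVn.contDiffAt ht, ← hn, hExp t, smul_eq_mul]
      ring
    have h3 := continuous_abs_rpow hs
    have h4 : ∫ t in (0:ℝ)..x, (x - t) ^ n / (n.factorial : ℝ) = x ^ (2 * D)
        / ((2 * D).factorial : ℝ) := by
      rw [intervalIntegral.integral_div, intervalIntegral.integral_comp_sub_left
        (fun t : ℝ => t ^ n), integral_pow, hn, Nat.factorial_succ]
      push_cast
      simp
      field_simp
    rw [h2, intervalIntegral.integral_add (Continuous.intervalIntegrable (by fun_prop) _ _)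
      (Continuous.intervalIntegrable (by fun_prop) _ _),
      intervalIntegral.integral_add (Continuous.intervalIntegrable (by fun_prop) _ _)
      (Continuous.intervalIntegrable (by fun_prop) _ _), intervalIntegral.integral_mul_const,
      intervalIntegral.integral_const_mul, h4, h1] at ht
    have h5 := integral_pow_mul_abs_rpow hD hs x
    rw [hn, Nat.add_sub_cancel] at h5
    rw [h5] at ht
    rw [Finset.sum_range_succ]
    linear_combination ht
  simp_rw [hrem]
  rw [Asymptotics.isLittleO_iff] at hr ⊢
  intro ε hε
  obtain ⟨η, hη, hb⟩ := Metric.eventually_nhds_iff.1 (hr hε)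
  refine Metric.eventually_nhds_iff.2 ⟨η, hη, fun x hx => ?_⟩
  rw [Real.dist_eq, sub_zero] at hx
  by_cases hx0 : x = 0
  · subst hx0
    rw [intervalIntegral.integral_same, norm_zero]
    positivity
  have hxp : 0 < |x| := abs_pos.2 hx0
  have hbound : ∀ t ∈ Set.uIoc 0 x, ‖(x - t) ^ n / (n.factorial : ℝ) * r t‖
      ≤ |x| ^ n * (ε * |x| ^ (s + γ)) := by
    intro t ht
    have ht' : |t| ≤ |x| ∧ |x - t| ≤ |x| := by
      rcases Set.mem_uIoc.1 ht with ⟨h1, h2⟩ | ⟨h1, h2⟩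
      · rw [abs_of_pos h1, abs_of_nonneg (sub_nonneg.2 h2), abs_of_pos (h1.trans_le h2)]
        exact ⟨h2, by linarith⟩
      · rw [abs_of_nonpos h2, abs_of_nonpos (by linarith : x - t ≤ 0),
          abs_of_neg (h1.trans_le h2)]
        exact ⟨by linarith, by linarith⟩
    have hrt := hb (y := t) (by rw [Real.dist_eq, sub_zero]; exact ht'.1.trans_lt hx)
    rw [Real.norm_of_nonneg (by positivity : 0 ≤ |t| ^ (s + γ))] at hrt
    have hfac : (1 : ℝ) ≤ n.factorial := by exact_mod_cast n.factorial_pos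
    rw [norm_mul, norm_div, norm_pow, Real.norm_eq_abs (x - t), Real.norm_natCast]
    refine mul_le_mul ?_ (hrt.trans ?_) (norm_nonneg _) (by positivity)
    · exact (div_le_self (by positivity) hfac).trans (pow_le_pow_left₀ (abs_nonneg _) ht'.2 n)
    · exact mul_le_mul_of_nonneg_left
        (Real.rpow_le_rpow (abs_nonneg _) ht'.1 (by positivity)) hε.le
  refine (intervalIntegral.norm_integral_le_of_norm_le_const hbound).trans (le_of_eq ?_)
  rw [sub_zero, Real.norm_of_nonneg (by positivity), add_assoc,
    Real.rpow_add hxp (2 * (D : ℝ)), show (2 * (D : ℝ)) = ((2 * D : ℕ) : ℝ) by push_cast; ring,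
    Real.rpow_natCast, hn, pow_succ]
  ring

end NearDiagonal

section DiagonalCovariance

variable {a : ℤ → ℝ} {L M : ℕ}

/-- Expansion of the variance of the increments for a small step. -/
lemma isLittleO_sum_cov (hm : ∀ k < M, ∑ j ∈ Finset.range L, a j * (j : ℝ) ^ k = 0)
    {V r : ℝ → ℝ} {D : ℕ} (hD : D < M) {c₁ s γ : ℝ} (hs : 0 < s) (hγ : 0 ≤ γ)
    (hV : ContDiff ℝ ((2 * D : ℕ) : ℕ∞) V)
    (hExp : ∀ h : ℝ, iteratedDeriv (2 * D) V h = iteratedDeriv (2 * D) V 0 + c₁ * |h| ^ s + r h)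
    (hr : r =o[nhds (0:ℝ)] fun h => |h| ^ (s + γ)) :
    (fun δ : ℝ => ∑ j ∈ Finset.range L, ∑ l ∈ Finset.range L, a j * a l * V (((j : ℝ) - l) * δ)
        - c₁ * (taylorConst D s * ∑ j ∈ Finset.range L, ∑ l ∈ Finset.range L,
          a j * a l * |(j : ℝ) - l| ^ (2 * (D : ℝ) + s)) * |δ| ^ (2 * (D : ℝ) + s))
      =o[nhds (0:ℝ)] fun δ => |δ| ^ (2 * (D : ℝ) + s + γ) := by
  have hE := isLittleO_taylor_rpow hs hγ hV hExp hr
  set E : ℝ → ℝ := fun x => V x - ∑ k ∈ Finset.range (2 * D + 1),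
        iteratedDeriv k V 0 / (k.factorial : ℝ) * x ^ k
        - c₁ * (taylorConst D s * |x| ^ (2 * (D : ℝ) + s)) with hEdef
  have hsum : ∀ δ : ℝ,
      ∑ j ∈ Finset.range L, ∑ l ∈ Finset.range L, a j * a l * V (((j : ℝ) - l) * δ)
        - c₁ * (taylorConst D s * ∑ j ∈ Finset.range L, ∑ l ∈ Finset.range L,
          a j * a l * |(j : ℝ) - l| ^ (2 * (D : ℝ) + s)) * |δ| ^ (2 * (D : ℝ) + s)
      = ∑ j ∈ Finset.range L, ∑ l ∈ Finset.range L, a j * a l * E (((j : ℝ) - l) * δ) := by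
    intro δ
    have h : ∀ j l : ℕ, a j * a l * E (((j : ℝ) - l) * δ) = a j * a l * V (((j : ℝ) - l) * δ)
        - c₁ * taylorConst D s * |δ| ^ (2 * (D : ℝ) + s)
          * (a j * a l * |(j : ℝ) - l| ^ (2 * (D : ℝ) + s))
        - ∑ k ∈ Finset.range (2 * D + 1), iteratedDeriv k V 0 / (k.factorial : ℝ) * δ ^ k
          * (a j * a l * ((j : ℝ) - l) ^ k) := by
      intro j l
      rw [hEdef]
      simp only
      rw [abs_mul, Real.mul_rpow (abs_nonneg _) (abs_nonneg _), mul_sub, mul_sub, Finset.mul_sum,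
        sub_right_comm]
      congr 1
      · ring
      · exact Finset.sum_congr rfl fun k _ => by rw [mul_pow]; ring
    simp_rw [h, Finset.sum_sub_distrib, ← Finset.mul_sum]
    have h3 : ∑ j ∈ Finset.range L, ∑ l ∈ Finset.range L, ∑ k ∈ Finset.range (2 * D + 1),
        iteratedDeriv k V 0 / (k.factorial : ℝ) * δ ^ k * (a j * a l * ((j : ℝ) - l) ^ k) = 0 := by
      have h4 : ∀ j ∈ Finset.range L, ∑ l ∈ Finset.range L, ∑ k ∈ Finset.range (2 * D + 1),
          iteratedDeriv k V 0 / (k.factorial : ℝ) * δ ^ k * (a j * a l * ((j : ℝ) - l) ^ k)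
          = ∑ k ∈ Finset.range (2 * D + 1), iteratedDeriv k V 0 / (k.factorial : ℝ) * δ ^ k *
            ∑ l ∈ Finset.range L, (a j * a l * ((j : ℝ) - l) ^ k) := fun j _ => by
        rw [Finset.sum_comm]
        exact Finset.sum_congr rfl fun k _ => by rw [Finset.mul_sum]
      rw [Finset.sum_congr rfl h4, Finset.sum_comm]
      refine Finset.sum_eq_zero fun k hk => ?_
      rw [← Finset.mul_sum, sum_moment_sub_eq_zero hm (by have := Finset.mem_range.1 hk; omega),
        mul_zero]
    rw [h3]
    ring
  simp_rw [hsum]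
  refine Asymptotics.IsLittleO.fun_sum fun j _ => Asymptotics.IsLittleO.fun_sum fun l _ => ?_
  refine Asymptotics.IsLittleO.const_mul_left ?_ _
  have ht : Tendsto (fun δ : ℝ => ((j : ℝ) - l) * δ) (nhds 0) (nhds 0) := by
    have : Continuous fun δ : ℝ => ((j : ℝ) - l) * δ := by fun_prop
    simpa using this.tendsto 0
  refine (hE.comp_tendsto ht).trans_isBigO ?_
  have e : ((fun x => |x| ^ (2 * (D : ℝ) + s + γ)) ∘ fun δ : ℝ => ((j : ℝ) - l) * δ)
      = fun δ => |(j : ℝ) - l| ^ (2 * (D : ℝ) + s + γ) * |δ| ^ (2 * (D : ℝ) + s + γ) := by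
    funext δ
    rw [Function.comp_apply, abs_mul, Real.mul_rpow (abs_nonneg _) (abs_nonneg _)]
  rw [e]
  exact Asymptotics.isBigO_const_mul_self _ _ _

end DiagonalCovariance

section RowSums

lemma tendsto_sum_rpow_div_sqrt {β : ℝ} (hβ : β < -(1 / 2)) :
    Tendsto (fun n : ℕ => (∑ k ∈ Finset.range n, ((k : ℝ) + 1) ^ β) / Real.sqrt n)
      atTop (nhds 0) := by
  set g : ℕ → ℝ := fun k => Real.sqrt ((k + 1 : ℕ) : ℝ) - Real.sqrt (k : ℝ) with hg
  have hg0 : ∀ k, 0 ≤ g k := fun k =>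
    sub_nonneg.2 (Real.sqrt_le_sqrt (by exact_mod_cast k.le_succ))
  have hsum : ∀ n, ∑ k ∈ Finset.range n, g k = Real.sqrt n := fun n => by
    rw [hg, Finset.sum_range_sub fun k : ℕ => Real.sqrt (k : ℝ)]
    simp
  have hlow : ∀ k : ℕ, 1 / 2 * ((k : ℝ) + 1) ^ (-(1 / 2) : ℝ) ≤ g k := by
    intro k
    have h1 : 0 < Real.sqrt ((k : ℝ) + 1) := Real.sqrt_pos.2 (by positivity)
    have h2 : Real.sqrt ((k : ℝ) + 1) ^ 2 = k + 1 := Real.sq_sqrt (by positivity)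
    have h3 : Real.sqrt (k : ℝ) ^ 2 = k := Real.sq_sqrt k.cast_nonneg
    rw [Real.rpow_neg (by positivity), ← Real.sqrt_eq_rpow, hg]
    push_cast
    rw [← div_eq_mul_inv, div_le_iff₀ h1]
    nlinarith [sq_nonneg (Real.sqrt ((k : ℝ) + 1) - Real.sqrt k)]
  have ho : (fun k : ℕ => ((k : ℝ) + 1) ^ β) =o[atTop] g := by
    refine Asymptotics.IsLittleO.trans_isBigO
      (g := fun k : ℕ => 1 / 2 * ((k : ℝ) + 1) ^ (-(1 / 2) : ℝ)) ?_ ?_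
    · refine Asymptotics.IsLittleO.const_mul_right (by norm_num) ?_
      have ht : Tendsto (fun k : ℕ => (k : ℝ) + 1) atTop atTop :=
        tendsto_natCast_atTop_atTop.atTop_add tendsto_const_nhds
      refine (Asymptotics.isLittleO_of_tendsto' (Eventually.of_forall fun k h => ?_) ?_)
      · exact absurd h (by positivity)
      · refine ((tendsto_rpow_neg_atTop (by linarith : 0 < -(β + 1 / 2))).comp ht).congr fun k => ?_
        have hk : (0 : ℝ) < (k : ℝ) + 1 := by positivity
        rw [Function.comp, ← Real.rpow_sub hk]
        congr 1
        ring
    · refine Asymptotics.IsBigO.of_bound 1 (Eventually.of_forall fun k => ?_)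
      rw [one_mul, Real.norm_of_nonneg (by positivity), Real.norm_of_nonneg (hg0 k)]
      exact hlow k
  have h := ho.sum_range hg0 (by
    simp_rw [hsum]
    exact Real.tendsto_sqrt_atTop.comp tendsto_natCast_atTop_atTop)
  simp_rw [hsum] at h
  exact h.tendsto_div_nhds_zero

lemma sum_fin_comp_abs_sub_le {N : ℕ} (H : ℝ → ℝ) (hH : ∀ x, 0 ≤ H x) (i : Fin N) :
    ∑ i' : Fin N, H |((i : ℕ) : ℝ) - ((i' : ℕ) : ℝ)| ≤ 2 * ∑ k ∈ Finset.range N, H k := by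
  rw [Fin.sum_univ_eq_sum_range (fun x : ℕ => H |((i : ℕ) : ℝ) - (x : ℝ)|) N,
    ← Finset.sum_range_add_sum_Ico _ i.2.le, two_mul]
  refine add_le_add ?_ ?_
  · have hinj : Set.InjOn (fun x : ℕ => (i : ℕ) - x) (Finset.range (i : ℕ) : Set ℕ) := by
      intro x hx y hy hxy
      simp only [Finset.coe_range, Set.mem_Iio] at hx hy
      simp only at hxy
      omega
    have e : ∑ x ∈ Finset.range (i : ℕ), H |((i : ℕ) : ℝ) - (x : ℝ)|
        = ∑ y ∈ (Finset.range (i : ℕ)).image (fun x : ℕ => (i : ℕ) - x), H (y : ℝ) := by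
      rw [Finset.sum_image hinj]
      refine Finset.sum_congr rfl fun x hx => ?_
      have hx' : x ≤ (i : ℕ) := (Finset.mem_range.1 hx).le
      rw [Nat.cast_sub hx', abs_of_nonneg]
      have : (x : ℝ) ≤ ((i : ℕ) : ℝ) := by exact_mod_cast hx'
      linarith
    rw [e]
    refine Finset.sum_le_sum_of_subset_of_nonneg (fun y hy => ?_) fun y _ _ => hH _
    obtain ⟨x, hx, rfl⟩ := Finset.mem_image.1 hy
    have := i.2
    rw [Finset.mem_range]
    omega
  · rw [Finset.sum_Ico_eq_sum_range]
    have e : ∀ k : ℕ, H |((i : ℕ) : ℝ) - (((i : ℕ) + k : ℕ) : ℝ)| = H (k : ℝ) := fun k => by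
      push_cast
      rw [sub_add_cancel_left, abs_neg, Nat.abs_cast]
    simp_rw [e]
    exact Finset.sum_le_sum_of_subset_of_nonneg
      (Finset.range_mono (Nat.sub_le _ _)) fun y _ _ => hH _

end RowSums

section CovarianceMatrix

variable {L : ℕ} {A : (n : ℕ) → Matrix (Fin (n - L + 1)) (Fin (n - L + 1)) ℝ}

lemma abs_mul_transpose_apply_le {ι : Type*} [Fintype ι] (A : Matrix ι ι ℝ) {v : ℝ}
    (hv : ∀ i, (A * Aᵀ) i i = v) (i i' : ι) : |(A * Aᵀ) i i'| ≤ v := by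
  have h1 := hv i
  have h2 := hv i'
  simp only [mul_apply, transpose_apply] at h1 h2 ⊢
  refine (Finset.abs_sum_le_sum_abs _ _).trans ?_
  have e : v = ∑ k, (A i k * A i k + A i' k * A i' k) / 2 := by
    rw [← Finset.sum_div, Finset.sum_add_distrib, h1, h2]
    ring
  rw [e]
  refine Finset.sum_le_sum fun k _ => ?_
  rw [abs_mul]
  nlinarith [sq_nonneg (|A i k| - |A i' k|), sq_abs (A i k), sq_abs (A i' k)]

/-- Consequences of the decay of the covariances: size of the Frobenius norm, of the row sums, and
of the bias of the trace. -/
lemma covariance_asymptotics (hL : 1 ≤ L) {u v : ℕ → ℝ} {κ c β : ℝ} (hκ : κ ≠ 0)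
    (hu : ∀ᶠ n in atTop, 0 < u n)
    (hdiag : ∀ n i, (A n * (A n)ᵀ) i i = v n)
    (hv : Tendsto (fun n : ℕ => (v n - κ * u n) / u n * Real.sqrt n) atTop (nhds 0))
    (hc : 0 ≤ c) (hβ : β < -(1 / 2))
    (hfar : ∀ᶠ n in atTop, ∀ i i' : Fin (n - L + 1),
      2 * (L : ℝ) ≤ ((i : ℕ) : ℝ) - ((i' : ℕ) : ℝ) →
      |(A n * (A n)ᵀ) i i'| ≤ c * u n * (((i : ℕ) : ℝ) - ((i' : ℕ) : ℝ) + 1) ^ β)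
    {F : ℕ → ℝ} (hF : ∀ n, F n = Real.sqrt (∑ i, ∑ j, ((A n * (A n)ᵀ) i j) ^ 2)) :
    0 < κ ∧ (∀ᶠ n : ℕ in atTop, κ / 4 * (Real.sqrt n * u n) ≤ F n) ∧
    ∃ b : ℕ → ℝ, (∀ᶠ n in atTop, 0 ≤ b n) ∧
      (∀ᶠ n in atTop, ∀ i, ∑ j, |(A n * (A n)ᵀ) i j| ≤ b n) ∧
      Tendsto (fun n => b n / F n) atTop (nhds 0) ∧
      Tendsto (fun n => ((A n * (A n)ᵀ).trace - κ * (n * u n)) / F n) atTop (nhds 0) := by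
  have hsqrt : Tendsto (fun n : ℕ => Real.sqrt n) atTop atTop :=
    Real.tendsto_sqrt_atTop.comp tendsto_natCast_atTop_atTop
  have hvu : Tendsto (fun n => v n / u n) atTop (nhds κ) := by
    have h1 := hv.div_atTop hsqrt
    have h2 := h1.add_const κ
    rw [zero_add] at h2
    refine h2.congr' ?_
    filter_upwards [hu, hsqrt.eventually_gt_atTop 0] with n hn hn2
    field_simp
    ring
  have hv0 : ∀ n, 0 ≤ v n := fun n => by
    rw [← hdiag n 0]
    simp only [mul_apply, transpose_apply]
    exact Finset.sum_nonneg fun k _ => mul_self_nonneg _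
  have hκ0 : 0 < κ := lt_of_le_of_ne (ge_of_tendsto hvu (hu.mono fun n hn =>
    div_nonneg (hv0 n) hn.le)) hκ.symm
  have hvlow : ∀ᶠ n in atTop, κ / 2 * u n ≤ v n := by
    filter_upwards [hu, hvu.eventually_const_le (by linarith : κ / 2 < κ)] with n hn h
    rwa [le_div_iff₀ hn] at h
  have hvup : ∀ᶠ n in atTop, v n ≤ 2 * κ * u n := by
    filter_upwards [hu, hvu.eventually_le_const (by linarith : κ < 2 * κ)] with n hn h
    rwa [div_le_iff₀ hn] at h
  have hFlow : ∀ᶠ n : ℕ in atTop, κ / 4 * (Real.sqrt n * u n) ≤ F n := by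
    filter_upwards [hu, hvlow, eventually_ge_atTop (2 * L)] with n hn hvn hLn
    rw [hF]
    refine Real.le_sqrt_of_sq_le ?_
    have h1 : ∑ i : Fin (n - L + 1), (v n) ^ 2 ≤ ∑ i, ∑ j, ((A n * (A n)ᵀ) i j) ^ 2 := by
      refine Finset.sum_le_sum fun i _ => ?_
      rw [← hdiag n i]
      exact Finset.single_le_sum (f := fun j => ((A n * (A n)ᵀ) i j) ^ 2)
        (fun j _ => sq_nonneg _) (Finset.mem_univ i)
    refine le_trans ?_ h1
    rw [Finset.sum_const, Finset.card_univ, Fintype.card_fin, nsmul_eq_mul]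
    have h2 : (n : ℝ) ≤ 4 * (n - L + 1 : ℕ) := by exact_mod_cast (by omega)
    have h3 : Real.sqrt n ^ 2 = n := Real.sq_sqrt n.cast_nonneg
    have h4 : (κ / 2 * u n) ^ 2 ≤ (v n) ^ 2 := pow_le_pow_left₀ (by positivity) hvn 2
    calc (κ / 4 * (Real.sqrt n * u n)) ^ 2 = n / 4 * (κ / 2 * u n) ^ 2 := by
          rw [mul_pow, mul_pow, h3]
          ring
      _ ≤ (n - L + 1 : ℕ) * (v n) ^ 2 :=
          mul_le_mul (by linarith) h4 (by positivity) (by positivity)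
  have hFw : ∀ᶠ n : ℕ in atTop, 0 < κ / 4 * (Real.sqrt n * u n) := by
    filter_upwards [hu, hsqrt.eventually_gt_atTop 0] with n h1 h2
    positivity
  set G : ℕ → ℝ := fun n => ∑ k ∈ Finset.range n, ((k : ℝ) + 1) ^ β with hG
  set c' : ℝ := c + 2 * κ * ((2 * (L : ℝ) + 1) ^ β)⁻¹ with hc'
  have hc'0 : 0 ≤ c' := by positivity
  have hall : ∀ᶠ n in atTop, ∀ i i' : Fin (n - L + 1), |(A n * (A n)ᵀ) i i'|
      ≤ c' * u n * (|((i : ℕ) : ℝ) - ((i' : ℕ) : ℝ)| + 1) ^ β := by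
    filter_upwards [hu, hvup, hfar] with n hn hvn hfn i i'
    have hcc : ∀ x : ℝ, 0 ≤ x → c * u n * (x + 1) ^ β ≤ c' * u n * (x + 1) ^ β := fun x hx => by
      have : c ≤ c' := by rw [hc']; exact le_add_of_nonneg_right (by positivity)
      gcongr
    rcases le_or_gt (2 * (L : ℝ)) (((i : ℕ) : ℝ) - ((i' : ℕ) : ℝ)) with h | h
    · have h0 : 0 ≤ ((i : ℕ) : ℝ) - ((i' : ℕ) : ℝ) := le_trans (by positivity) h
      rw [abs_of_nonneg h0]
      exact (hfn i i' h).trans (hcc _ h0)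
    rcases le_or_gt (2 * (L : ℝ)) (((i' : ℕ) : ℝ) - ((i : ℕ) : ℝ)) with h' | h'
    · have h0 : 0 ≤ ((i' : ℕ) : ℝ) - ((i : ℕ) : ℝ) := le_trans (by positivity) h'
      have hsymm : (A n * (A n)ᵀ) i i' = (A n * (A n)ᵀ) i' i := by
        simp only [mul_apply, transpose_apply]
        exact Finset.sum_congr rfl fun k _ => mul_comm _ _
      rw [abs_sub_comm ((i : ℕ) : ℝ), abs_of_nonneg h0, hsymm]
      exact (hfn i' i h').trans (hcc _ h0)
    · have hx : |((i : ℕ) : ℝ) - ((i' : ℕ) : ℝ)| ≤ 2 * (L : ℝ) :=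
        abs_le.2 ⟨by linarith, by linarith⟩
      have hp : (2 * (L : ℝ) + 1) ^ β ≤ (|((i : ℕ) : ℝ) - ((i' : ℕ) : ℝ)| + 1) ^ β :=
        Real.rpow_le_rpow_of_nonpos (by positivity) (by linarith) (by linarith)
      have hp0 : 0 < (2 * (L : ℝ) + 1) ^ β := by positivity
      calc |(A n * (A n)ᵀ) i i'| ≤ v n := abs_mul_transpose_apply_le _ (hdiag n) i i'
        _ ≤ 2 * κ * u n := hvn
        _ = 2 * κ * ((2 * (L : ℝ) + 1) ^ β)⁻¹ * u n * (2 * (L : ℝ) + 1) ^ β := by field_simp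
        _ ≤ c' * u n * (|((i : ℕ) : ℝ) - ((i' : ℕ) : ℝ)| + 1) ^ β := by
          refine mul_le_mul ?_ hp hp0.le (by positivity)
          exact mul_le_mul_of_nonneg_right (le_add_of_nonneg_left hc) hn.le
  refine ⟨hκ0, hFlow, fun n => 2 * c' * u n * G n, ?_, ?_, ?_, ?_⟩
  · filter_upwards [hu] with n hn
    positivity
  · filter_upwards [hu, hall, eventually_ge_atTop L] with n hn h hLn i
    refine (Finset.sum_le_sum fun i' _ => h i i').trans ?_
    rw [← Finset.mul_sum]
    have h1 := sum_fin_comp_abs_sub_le (fun x => (|x| + 1) ^ β) (fun x => by positivity) i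
    simp only [abs_abs, Nat.abs_cast] at h1
    have h2 : ∑ k ∈ Finset.range (n - L + 1), ((k : ℝ) + 1) ^ β ≤ G n :=
      Finset.sum_le_sum_of_subset_of_nonneg (Finset.range_mono (by omega))
        fun k _ _ => by positivity
    calc c' * u n * ∑ i' : Fin (n - L + 1), (|((i : ℕ) : ℝ) - ((i' : ℕ) : ℝ)| + 1) ^ β
        ≤ c' * u n * (2 * G n) := by
          refine mul_le_mul_of_nonneg_left (h1.trans ?_) (by positivity)
          linarith
      _ = _ := by ring
  · have h0 := (tendsto_sum_rpow_div_sqrt hβ).const_mul (8 * c' / κ)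
    rw [mul_zero] at h0
    refine squeeze_zero' ?_ ?_ h0
    · filter_upwards [hu, hFlow, hFw] with n hn h1 h2
      have : 0 < F n := h2.trans_le h1
      positivity
    · filter_upwards [hu, hFlow, hFw, hsqrt.eventually_gt_atTop 0] with n hn h1 h2 h3
      have hG0 : 0 ≤ G n := Finset.sum_nonneg fun k _ => by positivity
      calc 2 * c' * u n * G n / F n ≤ 2 * c' * u n * G n / (κ / 4 * (Real.sqrt n * u n)) := by
            gcongr
        _ = 8 * c' / κ * (G n / Real.sqrt n) := by
            field_simp
            ring
  · have h0 : Tendsto (fun n : ℕ => 4 / κ * (|(v n - κ * u n) / u n * Real.sqrt n|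
        + L * κ / Real.sqrt n)) atTop (nhds 0) := by
      have := (hv.abs.add (hsqrt.const_div_atTop (L * κ))).const_mul (4 / κ)
      simpa using this
    refine squeeze_zero_norm' ?_ h0
    filter_upwards [hu, hFlow, hFw, hsqrt.eventually_gt_atTop 0, eventually_ge_atTop L]
      with n hn h1 h2 h3 hLn
    have hFn : 0 < F n := h2.trans_le h1
    have hsq : Real.sqrt n * Real.sqrt n = n := Real.mul_self_sqrt n.cast_nonneg
    have htr : (A n * (A n)ᵀ).trace = (n - L + 1 : ℕ) * v n := by
      simp [trace, hdiag n]
    have hN : ((n - L + 1 : ℕ) : ℝ) = n - L + 1 := by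
      push_cast [Nat.cast_sub hLn]
      ring
    have hL' : (1 : ℝ) ≤ L := by exact_mod_cast hL
    have hLn' : (L : ℝ) ≤ n := by exact_mod_cast hLn
    have hnum : |(A n * (A n)ᵀ).trace - κ * (n * u n)|
        ≤ n * |v n - κ * u n| + L * κ * u n := by
      have e : (A n * (A n)ᵀ).trace - κ * (n * u n)
          = (n - L + 1) * (v n - κ * u n) - (L - 1) * (κ * u n) := by
        rw [htr, hN]
        ring
      rw [e]
      refine (abs_sub _ _).trans (add_le_add ?_ ?_)
      · rw [abs_mul, abs_of_nonneg (by linarith : (0 : ℝ) ≤ n - L + 1)]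
        exact mul_le_mul_of_nonneg_right (by linarith) (abs_nonneg _)
      · rw [abs_of_nonneg (mul_nonneg (by linarith) (by positivity)), mul_assoc]
        exact mul_le_mul_of_nonneg_right (by linarith) (by positivity)
    rw [norm_div, Real.norm_eq_abs, Real.norm_of_nonneg hFn.le]
    calc |(A n * (A n)ᵀ).trace - κ * (n * u n)| / F n
        ≤ (n * |v n - κ * u n| + L * κ * u n) / (κ / 4 * (Real.sqrt n * u n)) :=
          div_le_div₀ (by positivity) hnum h2 h1
      _ = 4 / κ * (|(v n - κ * u n) / u n * Real.sqrt n| + L * κ / Real.sqrt n) := by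
          rw [abs_mul, abs_div, abs_of_pos hn, abs_of_pos h3]
          field_simp
          rw [pow_two, hsq]
          ring

end CovarianceMatrix

/-- under (H0)–(H3), with a drift `f` that is `M` times continuously
differentiable on `[0,∞)` and whose `M`-th derivative satisfies
`K^α_{M,n} = o(n^{−1/4} δ_n^{D−M+s/2})`, the estimator built from the drifted observations
`Δ_{a,i}(f) + Z^{(n)}_i` is still asymptotically normal:
`(C^X_{a,n} − C)/√Var(C_{a,n}) → N(0,1)` in distribution. -/
theorem stmt_12 (V r : ℝ → ℝ) (D : ℕ) (C s α : ℝ)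
    (hC : 0 < C) (hs0 : 0 < s) (hs2 : s < 2) (hα0 : 0 < α) (hα1 : α ≤ 1)
    -- (H0)
    (hEven : ∀ h : ℝ, V (-h) = V h) (hSmooth : ContDiffOn ℝ (⊤ : ℕ∞) V (Set.Ioi 0))
    -- (H1)
    (hV2D : ContDiff ℝ ((2 * D : ℕ) : ℕ∞) V)
    (hExp : ∀ h : ℝ, iteratedDeriv (2 * D) V h
      = iteratedDeriv (2 * D) V 0 + C * (-1 : ℝ) ^ D * |h| ^ s + r h)
    (hro : r =o[nhds (0:ℝ)] fun h => |h| ^ s)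
    -- (H2), with d = 2 if s < 3/2 and d = 3 otherwise
    (hrd : ContDiffOn ℝ ((if s < 3/2 then 2 else 3 : ℕ) : ℕ∞) r {(0:ℝ)}ᶜ)
    (hH2 : ∃ β K : ℝ, s - (if s < 3/2 then 2 else 3 : ℕ) < β ∧ β < -(1/2) ∧ 0 < K ∧
      (∀ h : ℝ, h ≠ 0 → |iteratedDeriv (if s < 3/2 then 2 else 3 : ℕ) r h| ≤ K * |h| ^ β) ∧
      (∀ h : ℝ, 1 < |h| → |r h| ≤ K * |h| ^ s))
    -- (H3)
    (hH3 : r =o[nhds (0:ℝ)] fun h => |h| ^ (s + 1 / (2 * α)))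
    -- variation sequence of length L and order M
    (a : ℤ → ℝ) (L M : ℕ) (hL : 1 ≤ L) (hM : 1 ≤ M)
    (hsupp : ∀ j : ℤ, a j ≠ 0 → 0 ≤ j ∧ j ≤ (L : ℤ) - 1)
    (ha0 : a 0 ≠ 0) (haL : a ((L : ℤ) - 1) ≠ 0)
    (hmom : ∀ k : ℕ, k < M → ∑ᶠ j : ℤ, a j * (j : ℝ) ^ k = 0)
    (hmomM : ∑ᶠ j : ℤ, a j * (j : ℝ) ^ M ≠ 0)
    (hMD : (D : ℝ) + s / 2 + 1 / 4 < M)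
    -- the centered Gaussian vector Z^{(n)}, realized as A_n G_n with A_n A_nᵀ = Σ_n
    (A : (n : ℕ) → Matrix (Fin (n - L + 1)) (Fin (n - L + 1)) ℝ)
    (hA : ∀ n : ℕ, ∀ i i' : Fin (n - L + 1),
      (A n * (A n)ᵀ) i i'
        = -∑ᶠ j : ℤ, seqConv a a j * V (((i : ℤ) - (i' : ℤ) + j) * (n : ℝ) ^ (-α)))
    -- the drift f, M times continuously differentiable on [0,∞)
    (f : ℝ → ℝ) (hf : ContDiffOn ℝ (M : ℕ∞) f (Set.Ici 0))
    -- K^α_{M,n} = o(n^{−1/4} δ_n^{D−M+s/2})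
    (hK : (fun n : ℕ =>
        sSup ((fun t => |iteratedDerivWithin M f (Set.Ici 0) t|) ''
          Set.Icc (0:ℝ) ((n : ℝ) ^ (1 - α))))
      =o[atTop] fun n : ℕ =>
        (n : ℝ) ^ (-(1/4) : ℝ) * ((n : ℝ) ^ (-α)) ^ ((D : ℝ) - (M : ℝ) + s / 2)) :
    -- conclusion: CLT for the estimator C^X_{a,n} built on the drifted observations
    ∀ g : BoundedContinuousFunction ℝ ℝ,
      Tendsto (fun n : ℕ =>
          ∫ z, g (((∑ i : Fin (n - L + 1),
                (driftDiff a f ((n : ℝ) ^ (-α)) ((i : ℕ) + 1) + z i) ^ 2)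
                  / denom a D s α n - C)
              / Real.sqrt (varV L A n / (denom a D s α n) ^ 2))
            ∂(gaussVec L A n))
        atTop (nhds (∫ x, g x ∂(gaussianReal 0 1))) := by
  have hm : ∀ k < M, ∑ j ∈ Finset.range L, a j * (j : ℝ) ^ k = 0 := fun k hk => by
    have h := hmom k hk
    rw [finsum_mul_eq_sum_range hsupp fun j => (j : ℝ) ^ k] at h
    simpa using h
  have hDM : D < M := by
    have : (D : ℝ) < M := by linarith
    exact_mod_cast this
  obtain ⟨β, K, hβ1, hβ2, -, hrK, -⟩ := hH2
  set d : ℕ := if s < 3 / 2 then 2 else 3 with hd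
  have hd0 : 0 < d := by rw [hd]; split_ifs <;> norm_num
  have hqd : 2 * D + d ≤ 2 * M := by
    rw [hd]
    split_ifs with h
    · omega
    · have : (D : ℝ) + 1 < M := by linarith
      have : D + 1 < M := by exact_mod_cast this
      omega
  set p : ℝ := 2 * (D : ℝ) + s with hp
  set Λ : ℝ := ∑ j ∈ Finset.range L, ∑ l ∈ Finset.range L, a j * a l * |(j : ℝ) - l| ^ p with hΛ
  have hΛ0 : Λ ≠ 0 := sum_abs_sub_rpow_ne_zero hm hL ha0 hDM (by linarith) (by linarith)
  have hρ : Rq 0 1 (2 * D) (fun x => |x| ^ s) (seqConv a a) = -(taylorConst D s * Λ) :=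
    Rq_seqConv_eq hsupp D hs0
  set u : ℕ → ℝ := fun n => ((n : ℝ) ^ (-α)) ^ p with hu
  set κ : ℝ := -(C * (-1 : ℝ) ^ D * (taylorConst D s * Λ)) with hκ
  have hκ0 : κ ≠ 0 := neg_ne_zero.2 (mul_ne_zero
    (mul_ne_zero hC.ne' (pow_ne_zero _ (by norm_num)))
    (mul_ne_zero (taylorConst_pos D hs0).ne' hΛ0))
  have hden : ∀ n, denom a D s α n = κ / C * (n * u n) := fun n => by
    rw [denom, hρ, hκ, ← hp, show ((n : ℝ) ^ (-α)) ^ p = u n from rfl]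
    field_simp
  have hδ : ∀ᶠ n : ℕ in atTop, 0 < (n : ℝ) ^ (-α) ∧ (n : ℝ) ^ (-α) ≤ 1 := by
    filter_upwards [eventually_ge_atTop 1] with n hn
    have hn' : (1 : ℝ) ≤ n := by exact_mod_cast hn
    exact ⟨Real.rpow_pos_of_pos (by linarith) _,
      Real.rpow_le_one_of_one_le_of_nonpos hn' (by linarith)⟩
  have hu0 : ∀ᶠ n in atTop, 0 < u n := hδ.mono fun n hn => Real.rpow_pos_of_pos hn.1 _
  have hδ0 : Tendsto (fun n : ℕ => (n : ℝ) ^ (-α)) atTop (nhds 0) :=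
    (tendsto_rpow_neg_atTop hα0).comp tendsto_natCast_atTop_atTop
  have hS : ∀ n, ∀ i i' : Fin (n - L + 1), (A n * (A n)ᵀ) i i'
      = -∑ j ∈ Finset.range L, ∑ l ∈ Finset.range L,
        a j * a l * V (((((i : ℕ) : ℝ) - ((i' : ℕ) : ℝ)) + ((j : ℝ) - l)) * (n : ℝ) ^ (-α)) := by
    intro n i i'
    rw [hA, finsum_seqConv_mul hsupp fun m => V (((i : ℤ) - (i' : ℤ) + m) * (n : ℝ) ^ (-α))]
    simp
  set v : ℕ → ℝ := fun n => -∑ j ∈ Finset.range L, ∑ l ∈ Finset.range L,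
    a j * a l * V (((j : ℝ) - l) * (n : ℝ) ^ (-α)) with hvdef
  have hdiag : ∀ n i, (A n * (A n)ᵀ) i i = v n := fun n i => by
    rw [hS, hvdef]
    simp
  have hv : Tendsto (fun n : ℕ => (v n - κ * u n) / u n * Real.sqrt n) atTop (nhds 0) := by
    have h := ((isLittleO_sum_cov hm hDM hs0 (by positivity : 0 ≤ 1 / (2 * α)) hV2D hExp
      hH3).comp_tendsto hδ0).tendsto_div_nhds_zero.neg
    rw [neg_zero] at h
    refine h.congr' ?_
    filter_upwards [hδ, hu0, eventually_gt_atTop 0] with n hn hun hn0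
    have hn0' : (0 : ℝ) < n := by exact_mod_cast hn0
    have e : ((n : ℝ) ^ (-α)) ^ (1 / (2 * α)) * Real.sqrt n = 1 := by
      rw [Real.sqrt_eq_rpow, ← Real.rpow_mul hn0'.le, ← Real.rpow_add hn0',
        show -α * (1 / (2 * α)) + 1 / 2 = 0 by field_simp; ring, Real.rpow_zero]
    have hpos := Real.rpow_pos_of_pos hn.1 (1 / (2 * α))
    simp only [Function.comp]
    rw [abs_of_pos hn.1, ← hp, ← hΛ, Real.rpow_add hn.1 p,
      show ((n : ℝ) ^ (-α)) ^ p = u n from rfl, ← neg_div, eq_comm, div_mul_eq_mul_div,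
      div_eq_div_iff hun.ne' (mul_pos hun hpos).ne']
    have e2 : v n - κ * u n = -(∑ j ∈ Finset.range L, ∑ l ∈ Finset.range L,
        a j * a l * V (((j : ℝ) - l) * (n : ℝ) ^ (-α))
        - C * (-1 : ℝ) ^ D * (taylorConst D s * Λ) * u n) := by
      rw [hvdef, hκ]
      ring
    rw [e2]
    linear_combination (-(∑ j ∈ Finset.range L, ∑ l ∈ Finset.range L,
        a j * a l * V (((j : ℝ) - l) * (n : ℝ) ^ (-α))
        - C * (-1 : ℝ) ^ D * (taylorConst D s * Λ) * u n)) * u n * e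
  obtain ⟨c, hc0, hc⟩ := exists_abs_sum_cov_le hm hL hd0 hqd hSmooth hExp hrd hrK hβ1 (by linarith)
  have hfar : ∀ᶠ n in atTop, ∀ i i' : Fin (n - L + 1),
      2 * (L : ℝ) ≤ ((i : ℕ) : ℝ) - ((i' : ℕ) : ℝ) →
      |(A n * (A n)ᵀ) i i'| ≤ c * u n * (((i : ℕ) : ℝ) - ((i' : ℕ) : ℝ) + 1) ^ β := by
    filter_upwards [hδ] with n hn i i' hi
    rw [hS, abs_neg]
    simpa [hu, hp] using hc _ _ hn.1 hn.2 hi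
  obtain ⟨hκpos, hFlow, b, hb0, hb, hbF, hE⟩ := covariance_asymptotics hL hκ0 hu0 hdiag hv hc0 hβ2
    hfar (F := fun n => Real.sqrt (∑ i, ∑ j, ((A n * (A n)ᵀ) i j) ^ 2)) fun n => rfl
  have hsu : ∀ᶠ n : ℕ in atTop, 0 < Real.sqrt n * u n := by
    filter_upwards [hu0, eventually_gt_atTop 0] with n hn hn0
    exact mul_pos (Real.sqrt_pos.2 (by exact_mod_cast hn0)) hn
  refine tendsto_integral_drifted_quadVar L A
    (fun n i => driftDiff a f ((n : ℝ) ^ (-α)) ((i : ℕ) + 1)) (denom a D s α) b _ C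
    (fun n => rfl) ?_ ?_ hb0 hb hbF ?_ ?_
  · filter_upwards [hFlow, hsu] with n h1 h2
    exact lt_of_lt_of_le (by positivity) h1
  · filter_upwards [hu0, eventually_gt_atTop 0] with n hn hn0
    rw [hden]
    positivity
  · refine hE.congr fun n => ?_
    rw [show C * denom a D s α n = κ * (n * u n) by rw [hden]; field_simp]
  · have h := (tendsto_sum_sq_driftDiff hsupp hM hm hL hf hK).const_mul (4 / κ)
    rw [mul_zero] at h
    refine squeeze_zero' (Eventually.of_forall fun n => by positivity) ?_ h
    filter_upwards [hFlow, hsu] with n h1 h2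
    refine (div_le_div_of_nonneg_left (by positivity) (by positivity) h1).trans_eq ?_
    change _ = 4 / κ * (_ / (Real.sqrt n * u n))
    field_simp
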